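/- arXiv:2307.03745 — 2 statements merged into one kernel-verified Lean document; each statement's English description precedes it below -/
import Mathlib

section
/- Let F be a field, let S = F[x_0,…,x_n] with homogeneous maximal ideal m = (x_0,…,x_n), and let f ∈ S be homogeneous of degree d whose Jacobian ideal J = (∂f/∂x_0, …, ∂f/∂x_n) satisfies that J + fS is m-primary (as holds when Proj S/fS is smooth). Then m^{n(d−2)+d} ⊆ J + fS. -/
open MvPolynomial

section ExtVanishing

open CategoryTheory Abelian

universe u

variable {R : Type u} [CommRing R]

/-- `Ext i (R/m, R/I) = 0` for all `i < j`, i.e. the `m`-depth of `R/I` is at least `j`. -/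
def ExtVanishing (m I : Ideal R) (j : ℕ) : Prop :=
  ∀ i < j, Subsingleton (Ext (ModuleCat.of R (R ⧸ m)) (ModuleCat.of R (R ⧸ I)) i)

lemma exact_lsmul_factor (I : Ideal R) (g : R) :
    Function.Exact (LinearMap.lsmul R (R ⧸ I) g)
      (Submodule.factor (le_sup_left : I ≤ I ⊔ Ideal.span {g})) := by
  intro x
  obtain ⟨x, rfl⟩ := Submodule.Quotient.mk_surjective _ x
  constructor
  · intro hx
    change Submodule.Quotient.mk x = _ at hx
    replace hx := (Submodule.Quotient.mk_eq_zero _).1 hx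
    obtain ⟨a, ha, b, hb, rfl⟩ := Submodule.mem_sup.1 hx
    obtain ⟨c, rfl⟩ := Ideal.mem_span_singleton'.1 hb
    refine ⟨Submodule.Quotient.mk c, (Submodule.Quotient.eq _).2 ?_⟩
    have : g • c - (a + c * g) = -a := by simp only [smul_eq_mul]; ring
    rw [this]
    exact I.neg_mem ha
  · rintro ⟨y, hy⟩
    obtain ⟨y, rfl⟩ := Submodule.Quotient.mk_surjective _ y
    rw [← hy]
    exact (Submodule.Quotient.mk_eq_zero _).2
      (Ideal.mem_sup_right (Ideal.mul_mem_right _ _ (Ideal.mem_span_singleton_self g)))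

/-- The complex `R/I → R/I → R/(I + (g))` whose first map is multiplication by `g`. -/
noncomputable def quotientMulComplex (I : Ideal R) (g : R) : ShortComplex (ModuleCat.{u} R) :=
  ModuleCat.shortComplexOfCompEqZero _ _ (exact_lsmul_factor I g).linearMap_comp_eq_zero

lemma quotientMulComplex_shortExact {I : Ideal R} {g : R} (hg : ∀ x, g * x ∈ I → x ∈ I) :
    (quotientMulComplex I g).ShortExact where
  exact := ModuleCat.shortComplex_exact _ (exact_lsmul_factor I g)
  mono_f := by
    refine (ModuleCat.mono_iff_injective _).2
      ((injective_iff_map_eq_zero (LinearMap.lsmul R (R ⧸ I) g)).2 fun x hx ↦ ?_)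
    obtain ⟨x, rfl⟩ := Submodule.Quotient.mk_surjective _ x
    exact (Submodule.Quotient.mk_eq_zero _).2 (hg x ((Submodule.Quotient.mk_eq_zero _).1 hx))
  epi_g := (ModuleCat.epi_iff_surjective _).2 (Submodule.factor_surjective le_sup_left)

lemma ExtVanishing.sup_span_singleton {m I : Ideal R} {g : R} {j : ℕ}
    (h : ExtVanishing m I (j + 1)) (hg : ∀ x, g * x ∈ I → x ∈ I) :
    ExtVanishing m (I ⊔ Ideal.span {g}) j := by
  intro i hi
  have h₀ := h i (by lia)
  have h₁ := h (i + 1) (by lia)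
  refine subsingleton_of_forall_eq 0 fun x ↦ ?_
  obtain ⟨y, rfl⟩ := Ext.covariant_sequence_exact₃ _ (quotientMulComplex_shortExact hg) x rfl
    (h₁.elim _ _)
  rw [show y = 0 from h₀.elim _ _]
  exact Ext.zero_comp ..

lemma ExtVanishing.of_sup_span_singleton {m I : Ideal R} {g : R} {j : ℕ}
    (h : ExtVanishing m (I ⊔ Ideal.span {g}) j) (hg : ∀ x, g * x ∈ I → x ∈ I) (hgm : g ∈ m) :
    ExtVanishing m I (j + 1) := by
  intro i hi
  refine subsingleton_of_forall_eq 0 fun x ↦ ?_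
  have hS := quotientMulComplex_shortExact hg
  have hzero : g • 𝟙 (ModuleCat.of R (R ⧸ m)) = 0 := by
    refine ModuleCat.hom_ext (LinearMap.ext fun x ↦ ?_)
    obtain ⟨x, rfl⟩ := Submodule.Quotient.mk_surjective m x
    exact (Submodule.Quotient.mk_eq_zero _).2 (Ideal.mul_mem_right _ _ hgm)
  have hx : x.comp (Ext.mk₀ (quotientMulComplex I g).f) (add_zero i) = 0 := by
    have h₁ : x.comp (Ext.mk₀ (quotientMulComplex I g).f) (add_zero i) = g • x := by
      rw [Ext.smul_eq_comp_mk₀]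
      rfl
    have h₂ : g • x = (Ext.mk₀ (g • 𝟙 _)).comp x (zero_add i) := by
      rw [Ext.mk₀_smul, Ext.smul_comp, Ext.mk₀_id_comp]
    rw [h₁, h₂, hzero, Ext.mk₀_zero]
    exact Ext.zero_comp ..
  cases i with
  | zero =>
    have := hS.mono_f
    exact Ext.postcomp_mk₀_injective_of_mono _ (quotientMulComplex I g).f
      (hx.trans (map_zero _).symm)
  | succ i =>
    obtain ⟨y, rfl⟩ := Ext.covariant_sequence_exact₁ _ hS x hx rfl
    rw [show y = 0 from (h i (by lia)).elim _ _]
    exact Ext.zero_comp ..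

lemma ExtVanishing.notMem_associatedPrimes [IsNoetherianRing R] {m I : Ideal R} {j : ℕ}
    (h : ExtVanishing m I (j + 1)) : m ∉ associatedPrimes R (R ⧸ I) := by
  intro hm
  obtain ⟨hprime, φ, hφ⟩ := (isAssociatedPrime_iff_exists_injective_linearMap _ _).1 hm
  have := Ext.homEquiv₀.subsingleton_congr.1 (h 0 (by lia))
  have hzero : φ = 0 := by
    have := congrArg ModuleCat.Hom.hom (this.elim (ModuleCat.ofHom φ) 0)
    simpa using this
  have : (1 : R ⧸ m) = 0 := hφ (by simp [hzero])
  exact hprime.ne_top ((Ideal.eq_top_iff_one _).2 (Ideal.Quotient.eq_zero_iff_mem.1 this))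

end ExtVanishing

section HilbertSeries

attribute [local instance] MvPolynomial.gradedAlgebra

variable {σ F : Type*} [Field F]

/-- The degree `k` part of an ideal of a polynomial ring. -/
noncomputable def gradedPiece (I : Ideal (MvPolynomial σ F)) (k : ℕ) :
    Submodule F (MvPolynomial σ F) :=
  homogeneousSubmodule σ F k ⊓ I.restrictScalars F

lemma mem_gradedPiece {I : Ideal (MvPolynomial σ F)} {k : ℕ} {p : MvPolynomial σ F} :
    p ∈ gradedPiece I k ↔ p.IsHomogeneous k ∧ p ∈ I := Iff.rfl

lemma homogeneousComponent_mul_add {g : MvPolynomial σ F} {e : ℕ} (hg : g.IsHomogeneous e)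
    (b : MvPolynomial σ F) (k : ℕ) :
    homogeneousComponent (e + k) (g * b) = g * homogeneousComponent k b := by
  have := DirectSum.coe_decompose_mul_add_of_left_mem (homogeneousSubmodule σ F) (j := k) (b := b)
    (show g ∈ homogeneousSubmodule σ F e from hg)
  rw [← decomposition.decompose'_apply, ← decomposition.decompose'_apply]
  exact this

lemma homogeneousComponent_mul_of_lt {g : MvPolynomial σ F} {e k : ℕ} (hg : g.IsHomogeneous e)
    (b : MvPolynomial σ F) (hk : k < e) : homogeneousComponent k (g * b) = 0 := by
  have := DirectSum.coe_decompose_mul_of_left_mem_of_not_le (homogeneousSubmodule σ F) (b := b)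
    (show g ∈ homogeneousSubmodule σ F e from hg) hk.not_ge
  rw [← decomposition.decompose'_apply]
  exact this

lemma isHomogeneous_sup_span_singleton {I : Ideal (MvPolynomial σ F)}
    (hI : I.IsHomogeneous (homogeneousSubmodule σ F)) {g : MvPolynomial σ F} {e : ℕ}
    (hg : g.IsHomogeneous e) :
    (I ⊔ Ideal.span {g}).IsHomogeneous (homogeneousSubmodule σ F) :=
  hI.sup (Ideal.homogeneous_span _ _ fun _ hx ↦ ⟨e, Set.mem_singleton_iff.1 hx ▸ hg⟩)

lemma gradedPiece_sup_span_singleton_of_lt {I : Ideal (MvPolynomial σ F)}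
    (hI : I.IsHomogeneous (homogeneousSubmodule σ F)) {g : MvPolynomial σ F} {e k : ℕ}
    (hg : g.IsHomogeneous e) (hk : k < e) :
    gradedPiece (I ⊔ Ideal.span {g}) k = gradedPiece I k := by
  refine le_antisymm (fun p ⟨hp, hpI⟩ ↦ ⟨hp, ?_⟩) fun p ⟨hp, hpI⟩ ↦ ⟨hp, Ideal.mem_sup_left hpI⟩
  obtain ⟨a, ha, b, hb, rfl⟩ := Submodule.mem_sup.1 hpI
  obtain ⟨c, rfl⟩ := Ideal.mem_span_singleton.1 hb
  rw [← homogeneousComponent_eq_self hp, map_add, homogeneousComponent_mul_of_lt hg c hk, add_zero]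
  exact homogeneousComponent_mem_of_mem hI ha k

lemma gradedPiece_sup_span_singleton {I : Ideal (MvPolynomial σ F)}
    (hI : I.IsHomogeneous (homogeneousSubmodule σ F)) {g : MvPolynomial σ F} {e : ℕ}
    (hg : g.IsHomogeneous e) (k : ℕ) :
    gradedPiece (I ⊔ Ideal.span {g}) (e + k) = gradedPiece I (e + k) ⊔
      (homogeneousSubmodule σ F k).map (LinearMap.mulLeft F g) := by
  refine le_antisymm ?_ (sup_le ?_ ?_)
  · rintro p ⟨hp, hpI⟩
    obtain ⟨a, ha, b, hb, rfl⟩ := Submodule.mem_sup.1 hpI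
    obtain ⟨c, rfl⟩ := Ideal.mem_span_singleton.1 hb
    rw [← homogeneousComponent_eq_self hp, map_add, homogeneousComponent_mul_add hg]
    exact Submodule.add_mem_sup
      ⟨homogeneousComponent_mem _ _, homogeneousComponent_mem_of_mem hI ha _⟩
      ⟨_, homogeneousComponent_mem _ _, rfl⟩
  · exact fun p ⟨hp, hpI⟩ ↦ ⟨hp, Ideal.mem_sup_left hpI⟩
  · rintro _ ⟨b, hb, rfl⟩
    exact ⟨hg.mul hb, Ideal.mem_sup_right (Ideal.mul_mem_right _ _ (Ideal.mem_span_singleton_self g))⟩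

lemma gradedPiece_inf_map_mulLeft {I : Ideal (MvPolynomial σ F)} {g : MvPolynomial σ F} {e : ℕ}
    (hg : g.IsHomogeneous e) (hreg : ∀ x, g * x ∈ I → x ∈ I) (k : ℕ) :
    gradedPiece I (e + k) ⊓ (homogeneousSubmodule σ F k).map (LinearMap.mulLeft F g) =
      (gradedPiece I k).map (LinearMap.mulLeft F g) := by
  ext p
  constructor
  · rintro ⟨⟨_, hpI⟩, b, hb, rfl⟩
    exact ⟨b, ⟨hb, hreg b hpI⟩, rfl⟩
  · rintro ⟨b, ⟨hb, hbI⟩, rfl⟩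
    exact ⟨⟨hg.mul hb, Ideal.mul_mem_left _ _ hbI⟩, b, hb, rfl⟩

/-- The Hilbert series of the quotient of a polynomial ring by a homogeneous ideal. -/
noncomputable def hilbertSeries (I : Ideal (MvPolynomial σ F)) : PowerSeries ℤ :=
  PowerSeries.mk fun k ↦
    (Module.finrank F (homogeneousSubmodule σ F k) : ℤ) - Module.finrank F (gradedPiece I k)

lemma hilbertSeries_idealOfVars : hilbertSeries (idealOfVars σ F) = 1 := by
  ext k
  rw [hilbertSeries, PowerSeries.coeff_mk, PowerSeries.coeff_one]
  split_ifs with hk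
  · subst hk
    have h : gradedPiece (idealOfVars σ F) 0 = ⊥ := by
      rw [eq_bot_iff]
      rintro p ⟨hp, hpI⟩
      obtain ⟨c, rfl⟩ : ∃ c, C c = p := by
        rw [SetLike.mem_coe, homogeneousSubmodule_zero, Submodule.mem_one] at hp
        exact hp
      have := (C_mem_pow_idealOfVars_iff (σ := σ) 1 c).1 (by simpa using hpI)
      simp_all
    rw [h, finrank_bot, homogeneousSubmodule_zero]
    have := finrank_span_singleton (K := F) (one_ne_zero : (1 : MvPolynomial σ F) ≠ 0)
    rw [Submodule.one_eq_span, this]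
    simp
  · have h : gradedPiece (idealOfVars σ F) k = homogeneousSubmodule σ F k := by
      refine inf_eq_left.2 fun p hp ↦ ?_
      rw [Submodule.restrictScalars_mem, ← pow_one (idealOfVars σ F), mem_pow_idealOfVars_iff']
      intro s hs
      exact IsHomogeneous.coeff_eq_zero hp (by lia)
    rw [h, sub_self]

variable [Finite σ]

instance (k : ℕ) : FiniteDimensional F (homogeneousSubmodule σ F k) :=
  Module.Finite.of_fg (homogeneousSubmodule_fg σ F k)

instance (I : Ideal (MvPolynomial σ F)) (k : ℕ) : FiniteDimensional F (gradedPiece I k) :=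
  Submodule.finiteDimensional_of_le (inf_le_left : _ ≤ homogeneousSubmodule σ F k)

lemma hilbertSeries_sup_span_singleton {I : Ideal (MvPolynomial σ F)}
    (hI : I.IsHomogeneous (homogeneousSubmodule σ F)) {g : MvPolynomial σ F} {e : ℕ}
    (hg : g.IsHomogeneous e) (hg₀ : g ≠ 0) (hreg : ∀ x, g * x ∈ I → x ∈ I) :
    hilbertSeries (I ⊔ Ideal.span {g}) = (1 - PowerSeries.X ^ e) * hilbertSeries I := by
  ext k
  rw [sub_mul, one_mul, map_sub, PowerSeries.coeff_X_pow_mul']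
  simp only [hilbertSeries, PowerSeries.coeff_mk]
  split_ifs with hk
  · obtain ⟨k, rfl⟩ := Nat.exists_eq_add_of_le hk
    have hinj : Function.Injective (LinearMap.mulLeft F g) := fun a b hab ↦ mul_left_cancel₀ hg₀ hab
    have hrank (V : Submodule F (MvPolynomial σ F)) :
        Module.finrank F (V.map (LinearMap.mulLeft F g)) = Module.finrank F V :=
      (Submodule.equivMapOfInjective _ hinj V).finrank_eq.symm
    have h := Submodule.finrank_sup_add_finrank_inf_eq (gradedPiece I (e + k))
      ((homogeneousSubmodule σ F k).map (LinearMap.mulLeft F g))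
    rw [← gradedPiece_sup_span_singleton hI hg, gradedPiece_inf_map_mulLeft hg hreg,
      hrank, hrank] at h
    rw [Nat.add_sub_cancel_left]
    lia
  · rw [gradedPiece_sup_span_singleton_of_lt hI hg (not_le.1 hk), sub_zero]

lemma pow_le_of_coeff_hilbertSeries_eq_zero {I : Ideal (MvPolynomial σ F)} {k : ℕ}
    (h : PowerSeries.coeff k (hilbertSeries I) = 0) : idealOfVars σ F ^ k ≤ I := by
  rw [hilbertSeries, PowerSeries.coeff_mk, sub_eq_zero, Nat.cast_inj] at h
  have heq : gradedPiece I k = homogeneousSubmodule σ F k :=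
    Submodule.eq_of_le_of_finrank_eq inf_le_left h.symm
  rw [pow_idealOfVars_eq_span, Ideal.span_le]
  rintro _ ⟨s, hs, rfl⟩
  exact (heq.ge (isHomogeneous_monomial 1 hs)).2

end HilbertSeries

section VariableChain

attribute [local instance] MvPolynomial.gradedAlgebra

variable {F : Type*} [Field F] {N : ℕ}

/-- The ideal generated by the first `k` variables. -/
noncomputable def idealOfFirstVars (F : Type*) [Field F] (N k : ℕ) :
    Ideal (MvPolynomial (Fin N) F) :=
  Ideal.span (X '' {i : Fin N | i.val < k})

lemma idealOfFirstVars_zero : idealOfFirstVars F N 0 = ⊥ := by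
  simp [idealOfFirstVars]

lemma idealOfFirstVars_self : idealOfFirstVars F N N = idealOfVars (Fin N) F := by
  simp [idealOfFirstVars]

lemma idealOfFirstVars_succ {k : ℕ} (hk : k < N) :
    idealOfFirstVars F N (k + 1) = idealOfFirstVars F N k ⊔ Ideal.span {X ⟨k, hk⟩} := by
  rw [idealOfFirstVars, idealOfFirstVars, ← Ideal.span_union, ← Set.image_singleton,
    ← Set.image_union]
  congr 2
  ext i
  simp only [Set.mem_ofPred_eq, Set.mem_union, Set.mem_singleton_iff, Fin.ext_iff]
  lia

lemma isHomogeneous_idealOfFirstVars (k : ℕ) :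
    (idealOfFirstVars F N k).IsHomogeneous (homogeneousSubmodule (Fin N) F) := by
  refine Ideal.homogeneous_span _ _ ?_
  rintro _ ⟨i, -, rfl⟩
  exact ⟨1, isHomogeneous_X F i⟩

lemma mem_idealOfFirstVars_of_X_mul_mem {k : ℕ} (hk : k < N) (p : MvPolynomial (Fin N) F)
    (hp : X ⟨k, hk⟩ * p ∈ idealOfFirstVars F N k) : p ∈ idealOfFirstVars F N k := by
  rw [idealOfFirstVars, mem_ideal_span_X_image] at hp ⊢
  intro s hs
  obtain ⟨i, hi, hne⟩ := hp (Finsupp.single ⟨k, hk⟩ 1 + s) (by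
    rw [mem_support_iff, coeff_X_mul]
    exact mem_support_iff.1 hs)
  have hik : (⟨k, hk⟩ : Fin N) ≠ i := by
    rintro rfl
    exact lt_irrefl k hi
  exact ⟨i, hi, by simpa [Finsupp.single_eq_of_ne' hik] using hne⟩

lemma hilbertSeries_idealOfFirstVars {k : ℕ} (hk : k ≤ N) :
    hilbertSeries (idealOfFirstVars F N k) =
      (1 - PowerSeries.X) ^ k * hilbertSeries (⊥ : Ideal (MvPolynomial (Fin N) F)) := by
  induction k with
  | zero => rw [idealOfFirstVars_zero, pow_zero, one_mul]
  | succ k ih =>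
    rw [idealOfFirstVars_succ hk, hilbertSeries_sup_span_singleton
      (isHomogeneous_idealOfFirstVars k) (isHomogeneous_X F _) (X_ne_zero _)
      (mem_idealOfFirstVars_of_X_mul_mem hk), ih (by lia)]
    ring

lemma one_sub_X_pow_mul_hilbertSeries_bot :
    (1 - PowerSeries.X) ^ N * hilbertSeries (⊥ : Ideal (MvPolynomial (Fin N) F)) = 1 := by
  rw [← hilbertSeries_idealOfFirstVars le_rfl, idealOfFirstVars_self, hilbertSeries_idealOfVars]

lemma extVanishing_idealOfFirstVars {j k : ℕ} (hjk : j + k = N) :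
    ExtVanishing (idealOfVars (Fin N) F) (idealOfFirstVars F N k) j := by
  induction j generalizing k with
  | zero => exact fun i hi ↦ absurd hi i.not_lt_zero
  | succ j ih =>
    have hk : k < N := by lia
    have hX : (X ⟨k, hk⟩ : MvPolynomial (Fin N) F) ∈ idealOfVars (Fin N) F :=
      Ideal.subset_span (Set.mem_range_self _)
    have hext := ih (k := k + 1) (by lia)
    rw [idealOfFirstVars_succ hk] at hext
    exact hext.of_sup_span_singleton (mem_idealOfFirstVars_of_X_mul_mem hk) hX

lemma extVanishing_bot :
    ExtVanishing (idealOfVars (Fin N) F) (⊥ : Ideal (MvPolynomial (Fin N) F)) N := by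
  have h := extVanishing_idealOfFirstVars (F := F) (add_zero N)
  rwa [idealOfFirstVars_zero] at h

end VariableChain

section CompleteIntersection

attribute [local instance] MvPolynomial.gradedAlgebra

lemma isMaximal_idealOfVars (σ F : Type*) [Field F] : (idealOfVars σ F).IsMaximal := by
  have : idealOfVars σ F = RingHom.ker (constantCoeff (R := F) (σ := σ)) := by
    ext p
    rw [← pow_one (idealOfVars σ F), mem_pow_idealOfVars_iff', RingHom.mem_ker,
      constantCoeff_eq]
    simp [Finsupp.degree_eq_zero_iff]
  rw [this]
  exact RingHom.ker_isMaximal_of_surjective _ fun c ↦ ⟨C c, constantCoeff_C _ c⟩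

variable {F : Type*} [Field F] [Infinite F]

/-- Linear prime avoidance: over an infinite field, a vector space `W` of polynomials that is not
contained in any associated prime of `S/I` contains a nonzerodivisor on `S/I`. -/
lemma exists_mem_regular {σ : Type*} [Finite σ] (I : Ideal (MvPolynomial σ F))
    (W : Submodule F (MvPolynomial σ F))
    (hW : ∀ P ∈ associatedPrimes (MvPolynomial σ F) (MvPolynomial σ F ⧸ I),
      ¬ (W : Set (MvPolynomial σ F)) ⊆ P) :
    ∃ g ∈ W, ∀ x, g * x ∈ I → x ∈ I := by
  by_contra! h
  let A := associatedPrimes (MvPolynomial σ F) (MvPolynomial σ F ⧸ I)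
  have : Finite A := (associatedPrimes.finite _ _).to_subtype
  obtain ⟨⟨P, hP⟩, htop⟩ := Subspace.exists_eq_top_of_iUnion_eq_univ
    (p := fun P : A ↦ (P.1.restrictScalars F).comap W.subtype) <| by
      refine Set.eq_univ_of_forall fun ⟨g, hg⟩ ↦ ?_
      obtain ⟨x, hx, hxI⟩ := h g hg
      have hmem : g ∈ ⋃ P ∈ A, (P : Set (MvPolynomial σ F)) := by
        rw [biUnion_associatedPrimes_eq_zero_divisors]
        exact ⟨Submodule.Quotient.mk x, (Submodule.Quotient.mk_eq_zero _).not.2 hxI,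
          (Submodule.Quotient.mk_eq_zero _).2 hx⟩
      obtain ⟨P, hP, hgP⟩ := Set.mem_iUnion₂.1 hmem
      exact Set.mem_iUnion.2 ⟨⟨P, hP⟩, hgP⟩
  refine hW P hP fun g hg ↦ ?_
  have : (⟨g, hg⟩ : W) ∈ (P.restrictScalars F).comap W.subtype := htop ▸ Submodule.mem_top
  exact this

variable {n d e r : ℕ} {ι : Type*} {f : MvPolynomial (Fin (n + 1)) F}
  {h : ι → MvPolynomial (Fin (n + 1)) F}

lemma exists_completeIntersection (hf : f.IsHomogeneous d) (hf₀ : f ≠ 0)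
    (hh : ∀ i, (h i).IsHomogeneous e)
    (hle : Ideal.span (Set.range h) ⊔ Ideal.span {f} ≤ idealOfVars _ F)
    (hpow : idealOfVars _ F ^ r ≤ Ideal.span (Set.range h) ⊔ Ideal.span {f})
    {k : ℕ} (hk : k ≤ n) :
    ∃ I : Ideal (MvPolynomial (Fin (n + 1)) F),
      I.IsHomogeneous (homogeneousSubmodule _ F) ∧ f ∈ I ∧
      I ≤ Ideal.span (Set.range h) ⊔ Ideal.span {f} ∧
      ExtVanishing (idealOfVars _ F) I (n - k) ∧
      hilbertSeries I = (1 - PowerSeries.X ^ e) ^ k * (1 - PowerSeries.X ^ d) *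
        hilbertSeries (⊥ : Ideal (MvPolynomial (Fin (n + 1)) F)) := by
  induction k with
  | zero =>
    have hreg : ∀ x, f * x ∈ (⊥ : Ideal (MvPolynomial (Fin (n + 1)) F)) → x ∈ (⊥ : Ideal _) :=
      fun x hx ↦ (mul_eq_zero.1 hx).resolve_left hf₀
    have hbot := Ideal.IsHomogeneous.bot (homogeneousSubmodule (Fin (n + 1)) F)
    refine ⟨⊥ ⊔ Ideal.span {f}, isHomogeneous_sup_span_singleton hbot hf,
      Ideal.mem_sup_right (Ideal.mem_span_singleton_self f), sup_le bot_le le_sup_right,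
      extVanishing_bot.sup_span_singleton hreg, ?_⟩
    rw [hilbertSeries_sup_span_singleton hbot hf hf₀ hreg, pow_zero, one_mul]
  | succ k ih =>
    obtain ⟨I, hI, hfI, hIle, hext, hilb⟩ := ih (by lia)
    have hmax := isMaximal_idealOfVars (Fin (n + 1)) F
    rw [show n - k = (n - (k + 1)) + 1 by lia] at hext
    obtain ⟨g, hgW, hreg⟩ := exists_mem_regular I (Submodule.span F (Set.range h)) <| by
      intro P hP hsub
      have hPprime : P.IsPrime := hP.isPrime
      have hIP : I ≤ P := by
        obtain ⟨-, x, rfl⟩ := isAssociatedPrime_iff.1 hP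
        intro a ha
        rw [Submodule.mem_colon_singleton]
        obtain ⟨x, rfl⟩ := Submodule.Quotient.mk_surjective _ x
        exact (Submodule.Quotient.mk_eq_zero _).2 (Ideal.mul_mem_right _ _ ha)
      have hsup : Ideal.span (Set.range h) ⊔ Ideal.span {f} ≤ P :=
        sup_le (Ideal.span_le.2 (Submodule.subset_span.trans hsub))
          ((Ideal.span_singleton_le_iff_mem P).2 (hIP hfI))
      have hmP := Ideal.IsPrime.le_of_pow_le (hpow.trans hsup)
      exact hext.notMem_associatedPrimes (hmax.eq_of_le hPprime.ne_top hmP ▸ hP)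
    have hge : g.IsHomogeneous e := by
      have : Submodule.span F (Set.range h) ≤ homogeneousSubmodule _ F e :=
        Submodule.span_le.2 (Set.range_subset_iff.2 hh)
      exact this hgW
    have hg₀ : g ≠ 0 := by
      rintro rfl
      have hone : (1 : MvPolynomial (Fin (n + 1)) F) ∈ I := hreg 1 (by simp)
      exact hmax.ne_top ((Ideal.eq_top_iff_one _).2 (hle (hIle hone)))
    refine ⟨I ⊔ Ideal.span {g}, isHomogeneous_sup_span_singleton hI hge, Ideal.mem_sup_left hfI,
      sup_le hIle ?_, hext.sup_span_singleton hreg, ?_⟩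
    · rw [Ideal.span_singleton_le_iff_mem]
      exact Ideal.mem_sup_left (Submodule.span_le_restrictScalars F _ _ hgW)
    · rw [hilbertSeries_sup_span_singleton hI hge hg₀ hreg, hilb]
      ring

lemma coeff_geom_sum_pow_mul_geom_sum {N : ℕ} (hN : n * (e - 1) + (d - 1) < N) :
    PowerSeries.coeff N ((∑ i ∈ Finset.range e, (PowerSeries.X : PowerSeries ℤ) ^ i) ^ n *
      ∑ i ∈ Finset.range d, PowerSeries.X ^ i) = 0 := by
  have hcoe (a : ℕ) : (∑ i ∈ Finset.range a, (PowerSeries.X : PowerSeries ℤ) ^ i) =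
      ((∑ i ∈ Finset.range a, (Polynomial.X : Polynomial ℤ) ^ i : Polynomial ℤ) :
        PowerSeries ℤ) := by
    rw [← Polynomial.coeToPowerSeries.ringHom_apply, map_sum]
    simp
  have hdeg (a : ℕ) :
      (∑ i ∈ Finset.range a, (Polynomial.X : Polynomial ℤ) ^ i).natDegree ≤ a - 1 := by
    refine Polynomial.natDegree_sum_le_of_forall_le _ _ fun i hi ↦ ?_
    rw [Polynomial.natDegree_X_pow]
    have := Finset.mem_range.1 hi
    lia
  rw [hcoe, hcoe, ← Polynomial.coe_pow, ← Polynomial.coe_mul, Polynomial.coeff_coe]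
  refine Polynomial.coeff_eq_zero_of_natDegree_lt (lt_of_le_of_lt ?_ hN)
  exact Polynomial.natDegree_mul_le_of_le (Polynomial.natDegree_pow_le_of_le n (hdeg e)) (hdeg d)

/-- Over an infinite field, if forms `h i` of degree `e` together with a nonzero form `f` of
degree `d` generate an ideal primary to the maximal ideal of the variables, then this ideal
contains all forms of degree greater than `n * (e - 1) + (d - 1)`. See `pow_idealOfVars_le` for
arbitrary fields. -/
lemma pow_idealOfVars_le_of_infinite (hf : f.IsHomogeneous d) (hf₀ : f ≠ 0)
    (hh : ∀ i, (h i).IsHomogeneous e)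
    (hle : Ideal.span (Set.range h) ⊔ Ideal.span {f} ≤ idealOfVars _ F)
    (hpow : idealOfVars _ F ^ r ≤ Ideal.span (Set.range h) ⊔ Ideal.span {f})
    {N : ℕ} (hN : n * (e - 1) + (d - 1) < N) :
    idealOfVars _ F ^ N ≤ Ideal.span (Set.range h) ⊔ Ideal.span {f} := by
  obtain ⟨I, -, -, hIle, -, hilb⟩ := exists_completeIntersection hf hf₀ hh hle hpow le_rfl
  refine (pow_le_of_coeff_hilbertSeries_eq_zero ?_).trans hIle
  have hgeom (a : ℕ) : (1 - PowerSeries.X ^ a : PowerSeries ℤ) =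
      (∑ i ∈ Finset.range a, PowerSeries.X ^ i) * (1 - PowerSeries.X) :=
    (geom_sum_mul_neg _ a).symm
  have heq : hilbertSeries I = (∑ i ∈ Finset.range e, PowerSeries.X ^ i) ^ n *
      ∑ i ∈ Finset.range d, PowerSeries.X ^ i := by
    rw [hilb, hgeom e, hgeom d, mul_pow]
    have := one_sub_X_pow_mul_hilbertSeries_bot (F := F) (N := n + 1)
    linear_combination ((∑ i ∈ Finset.range e, PowerSeries.X ^ i) ^ n *
      ∑ i ∈ Finset.range d, PowerSeries.X ^ i) * this
  rw [heq]
  exact coeff_geom_sum_pow_mul_geom_sum hN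

end CompleteIntersection

section BaseChange

attribute [local instance] MvPolynomial.algebraMvPolynomial

lemma comap_map_map_eq_self {σ F K : Type*} [Field F] [Field K] [Algebra F K]
    (I : Ideal (MvPolynomial σ F)) :
    (I.map (MvPolynomial.map (algebraMap F K))).comap (MvPolynomial.map (algebraMap F K)) = I := by
  have : Module.Free (MvPolynomial σ F) (MvPolynomial σ K) :=
    IsBaseChange.free (Algebra.IsPushout.out (R := F) (S := MvPolynomial σ F) (R' := K)
      (S' := MvPolynomial σ K))
  exact Ideal.comap_map_eq_self_of_faithfullyFlat I

end BaseChange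

section

variable {F : Type*} [Field F] {n d e r : ℕ} {ι : Type*} {f : MvPolynomial (Fin (n + 1)) F}
  {h : ι → MvPolynomial (Fin (n + 1)) F}

/-- If forms `h i` of degree `e` together with a nonzero form `f` of degree `d` generate an ideal
primary to the maximal ideal of the variables, then this ideal contains all forms of degree
greater than `n * (e - 1) + (d - 1)`. -/
theorem pow_idealOfVars_le (hf : f.IsHomogeneous d) (hf₀ : f ≠ 0)
    (hh : ∀ i, (h i).IsHomogeneous e)
    (hle : Ideal.span (Set.range h) ⊔ Ideal.span {f} ≤ idealOfVars _ F)
    (hpow : idealOfVars _ F ^ r ≤ Ideal.span (Set.range h) ⊔ Ideal.span {f})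
    {N : ℕ} (hN : n * (e - 1) + (d - 1) < N) :
    idealOfVars _ F ^ N ≤ Ideal.span (Set.range h) ⊔ Ideal.span {f} := by
  let K := AlgebraicClosure F
  let φ := MvPolynomial.map (σ := Fin (n + 1)) (algebraMap F K)
  have hvars : (idealOfVars (Fin (n + 1)) F).map φ = idealOfVars _ K := by
    rw [Ideal.map_span, ← Set.range_comp]
    congr 2
    ext1 i
    exact map_X _ i
  have hmap : (Ideal.span (Set.range h) ⊔ Ideal.span {f}).map φ =
      Ideal.span (Set.range (φ ∘ h)) ⊔ Ideal.span {φ f} := by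
    rw [Ideal.map_sup, Ideal.map_span, Ideal.map_span, ← Set.range_comp, Set.image_singleton]
  have hinf : Infinite K := IsAlgClosed.instInfinite
  have key : idealOfVars _ K ^ N ≤ Ideal.span (Set.range (φ ∘ h)) ⊔ Ideal.span {φ f} := by
    refine pow_idealOfVars_le_of_infinite (f := φ f) (h := φ ∘ h) (r := r) (hf.map _) ?_
      (fun i ↦ (hh i).map _) ?_ ?_ hN
    · exact (map_ne_zero_iff φ (map_injective _ (algebraMap F K).injective)).2 hf₀
    · rw [← hmap, ← hvars]
      exact Ideal.map_mono hle
    · rw [← hmap, ← hvars, ← Ideal.map_pow]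
      exact Ideal.map_mono hpow
  rw [← hmap, ← hvars, ← Ideal.map_pow, Ideal.map_le_iff_le_comap, comap_map_map_eq_self] at key
  exact key

lemma eq_zero_of_isHomogeneous_zero_of_mem {σ : Type*} {p : MvPolynomial σ F}
    (hp : p.IsHomogeneous 0) (hmem : p ∈ idealOfVars σ F) : p = 0 := by
  ext s
  by_cases hs : s.degree = 0
  · rw [← pow_one (idealOfVars σ F), mem_pow_idealOfVars_iff'] at hmem
    exact hmem s (by lia)
  · exact hp.coeff_eq_zero hs

end

/-- **Lemma 2.1.** Let `S = F[x_0, …, x_n]` with homogeneous maximal ideal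
`m = (x_0, …, x_n)`, and let `f ∈ S` be homogeneous of degree `d` whose Jacobian ideal
`J = (∂f/∂x_0, …, ∂f/∂x_n)` satisfies that `J + fS` is `m`-primary. Then
`m ^ (n*(d-2) + d) ⊆ J + fS` (with the convention `m^i = S` for `i ≤ 0`). -/
theorem stmt_0 {F : Type*} [Field F] (n d : ℕ)
    (f : MvPolynomial (Fin (n + 1)) F) (hf : f.IsHomogeneous d)
    (m J : Ideal (MvPolynomial (Fin (n + 1)) F))
    (hm : m = Ideal.span (Set.range X))
    (hJ : J = Ideal.span (Set.range fun i => pderiv i f))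
    (hprimary : (J + Ideal.span {f}).radical = m) :
    m ^ (((n : ℤ) * ((d : ℤ) - 2) + d).toNat) ≤ J + Ideal.span {f} := by
  subst hm hJ
  rw [Submodule.add_eq_sup] at hprimary ⊢
  have hle := Ideal.le_radical.trans hprimary.le
  obtain ⟨r, hpow⟩ := Ideal.exists_radical_pow_le_of_fg
    (Ideal.span (Set.range fun i => pderiv i f) ⊔ Ideal.span {f}) (IsNoetherian.noetherian _)
  rw [hprimary] at hpow
  have hf₀ : f ≠ 0 := by
    rintro rfl
    have hX : (X 0 : MvPolynomial (Fin (n + 1)) F) ∈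
        (Ideal.span (Set.range fun i => pderiv i (0 : MvPolynomial (Fin (n + 1)) F)) ⊔
          Ideal.span {0}).radical := hprimary ▸ Ideal.subset_span (Set.mem_range_self 0)
    obtain ⟨k, hk⟩ := hX
    simp at hk
  have hderiv (i : Fin (n + 1)) : pderiv i f ∈ idealOfVars _ F :=
    hle (Ideal.mem_sup_left (Ideal.subset_span ⟨i, rfl⟩))
  have hd : 2 ≤ d := by
    by_contra! hlt
    interval_cases d
    · exact hf₀ (eq_zero_of_isHomogeneous_zero_of_mem hf
        (hle (Ideal.mem_sup_right (Ideal.mem_span_singleton_self f))))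
    · have hzero (i : Fin (n + 1)) : pderiv i f = 0 :=
        eq_zero_of_isHomogeneous_zero_of_mem hf.pderiv (hderiv i)
      exact hf₀ (by simpa [hzero] using hf.sum_X_mul_pderiv.symm)
  refine pow_idealOfVars_le hf hf₀ (fun i ↦ hf.pderiv) hle hpow ?_
  obtain ⟨c, rfl⟩ := Nat.exists_eq_add_of_le hd
  have : ((n : ℤ) * (((2 + c : ℕ) : ℤ) - 2) + ((2 + c : ℕ) : ℤ)) = ((n * c + 2 + c : ℕ) : ℤ) := by
    push_cast
    ring
  rw [this, Int.toNat_natCast, show 2 + c - 1 - 1 = c by lia]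
  lia
end

section
/- Let S = F[x_0,…,x_n] be a polynomial ring over a field F of characteristic p > 0, with m = (x_0,…,x_n). Let f_1,…,f_c be a regular sequence of homogeneous forms in S of degrees d_1,…,d_c, set d := d_1 + ⋯ + d_c, and let J be the ideal generated by the c×c minors of the (n+1)×c Jacobian matrix (∂f_j/∂x_i). Assume J + (f_1,…,f_c)S is m-primary (as holds when Proj S/(f_1,…,f_c)S is smooth). Let t be an integer with 1 ≤ t ≤ p and t·d_i ≥ (n+1−c)(d−c)+1 for each 1 ≤ i ≤ c. Let q = p^e with e ≥ 1, and let s ∈ S be homogeneous of degree (n+1)q/p − d such that f_i·s ∈ m^{[q/p]} for each i and s^p ∉ m^{[q]}. Then (f_1⋯f_c)^{p−t}·s^p ∉ m^{[q]}. -/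
open MvPolynomial

/-- `h` is a nonzerodivisor modulo the ideal `I`. -/
def NzdMod {R : Type*} [CommRing R] (I : Ideal R) (h : R) : Prop :=
  ∀ v, h * v ∈ I → v ∈ I

/-- The list is a weakly regular sequence on `R ⧸ I`. -/
def RegMod {R : Type*} [CommRing R] : Ideal R → List R → Prop
  | _, [] => True
  | I, h :: l => NzdMod I h ∧ RegMod (I ⊔ Ideal.span {h}) l

section CommRing

variable {R : Type*} [CommRing R]

lemma regMod_append {I : Ideal R} {l l' : List R} :
    RegMod I (l ++ l') ↔ RegMod I l ∧ RegMod (I ⊔ Ideal.ofList l) l' := by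
  induction l generalizing I with
  | nil => simp [RegMod]
  | cons h l ih => simp [RegMod, ih, Ideal.ofList_cons, sup_assoc, and_assoc]

lemma regMod_insert {I : Ideal R} {l : List R} {z : R} (hl : RegMod I l)
    (hz : ∀ l', l' <+: l → NzdMod (I ⊔ Ideal.ofList l') z) :
    RegMod (I ⊔ Ideal.span {z}) l := by
  induction l generalizing I with
  | nil => trivial
  | cons h l ih =>
    obtain ⟨h1, h2⟩ := hl
    refine ⟨fun v hv => ?_, ?_⟩
    · obtain ⟨a, ha, b, hb, hab⟩ := Submodule.mem_sup.1 hv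
      obtain ⟨w, rfl⟩ := Ideal.mem_span_singleton'.1 hb
      have hw : w ∈ I ⊔ Ideal.span {h} := by
        have := hz [h] (by simp) w
        simp only [Ideal.ofList_singleton] at this
        apply this
        have : z * w = h * v - a := by rw [← hab]; ring
        rw [this]
        exact sub_mem
          (Ideal.mem_sup_right (Ideal.mul_mem_right _ _ (Ideal.mem_span_singleton_self h)))
          (Ideal.mem_sup_left ha)
      obtain ⟨a', ha', b', hb', hab'⟩ := Submodule.mem_sup.1 hw
      obtain ⟨w', rfl⟩ := Ideal.mem_span_singleton'.1 hb'
      have : v - z * w' ∈ I := by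
        apply h1
        have : h * (v - z * w') = a + z * a' := by
          linear_combination -hab - z * hab'
        rw [this]
        exact add_mem ha (Ideal.mul_mem_left _ _ ha')
      rw [← sub_add_cancel v (z * w')]
      exact add_mem (Ideal.mem_sup_left this)
        (Ideal.mem_sup_right (Ideal.mul_mem_right _ _ (Ideal.mem_span_singleton_self z)))
    · rw [sup_right_comm]
      refine ih h2 fun l' hl' => ?_
      have := hz (h :: l') (by simpa using hl')
      rwa [Ideal.ofList_cons, ← sup_assoc] at this

lemma regMod_of_getElem {I : Ideal R} {l : List R}
    (h : ∀ (i : ℕ) (hi : i < l.length), NzdMod (I ⊔ Ideal.ofList (l.take i)) l[i]) :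
    RegMod I l := by
  induction l generalizing I with
  | nil => trivial
  | cons a l ih =>
    have h0 : NzdMod (I ⊔ Ideal.ofList []) a := h 0 (by simp)
    refine ⟨by simpa using h0, ih fun i hi => ?_⟩
    have := h (i + 1) (by simpa using hi)
    simpa [Ideal.ofList_cons, sup_assoc] using this

lemma regMod_bot_of_isWeaklyRegular {l : List R}
    (h : RingTheory.Sequence.IsWeaklyRegular R l) : RegMod ⊥ l := by
  refine regMod_of_getElem fun i hi v hv => ?_
  rw [bot_sup_eq] at hv ⊢
  have := h.regular_mod_prev i hi
  rw [isSMulRegular_iff_right_eq_zero_of_smul] at this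
  have h2 := this (Submodule.Quotient.mk v)
  rw [← Submodule.Quotient.mk_smul, Submodule.Quotient.mk_eq_zero,
    Submodule.Quotient.mk_eq_zero] at h2
  simpa using h2 (by simpa using hv)

lemma ne_zero_of_regMod {I m : Ideal R} {l : List R} (hm : m ≠ ⊤) (hI : I ≤ m)
    (hl : ∀ h ∈ l, h ∈ m) (hreg : RegMod I l) : ∀ h ∈ l, h ≠ 0 := by
  induction l generalizing I with
  | nil => simp
  | cons a l ih =>
    simp only [List.mem_cons, forall_eq_or_imp] at hl ⊢
    refine ⟨?_, ih (sup_le hI ((Ideal.span_singleton_le_iff_mem _).2 hl.1)) hl.2 hreg.2⟩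
    rintro rfl
    exact hm ((Ideal.eq_top_iff_one _).2 (hI (hreg.1 1 (by simp))))

end CommRing

section Poly

variable {σ K : Type*} [Field K]

/-- No nonzero element of the quotient by `I` is annihilated by all variables. -/
def NoSocle (I : Ideal (MvPolynomial σ K)) : Prop :=
  ∀ u, (∀ i, X i * u ∈ I) → u ∈ I

lemma mul_mem_of_X_mul_mem {I : Ideal (MvPolynomial σ K)} {u h : MvPolynomial σ K}
    (hu : ∀ i, X i * u ∈ I) (hh : h ∈ Ideal.span (Set.range (X : σ → MvPolynomial σ K))) :
    h * u ∈ I := by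
  have : Ideal.span (Set.range (X : σ → MvPolynomial σ K)) ≤
      Submodule.comap (LinearMap.mulRight (MvPolynomial σ K) u) I := by
    rw [Ideal.span_le]
    rintro _ ⟨i, rfl⟩
    exact hu i
  exact this hh

lemma NzdMod.noSocle {I : Ideal (MvPolynomial σ K)} {h : MvPolynomial σ K} (hn : NzdMod I h)
    (hh : h ∈ Ideal.span (Set.range (X : σ → MvPolynomial σ K))) : NoSocle I :=
  fun u hu => hn u (mul_mem_of_X_mul_mem hu hh)

lemma exists_nzdMod [Infinite K] [Finite σ] (A : Set (Ideal (MvPolynomial σ K))) (hA : A.Finite)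
    (V : Submodule K (MvPolynomial σ K)) (hsoc : ∀ I ∈ A, NoSocle I)
    (hV : ∀ I ∈ A, ∀ P : Ideal (MvPolynomial σ K), P.IsPrime → I ≤ P →
      (V : Set (MvPolynomial σ K)) ⊆ P → ∀ i, X i ∈ P) :
    ∃ v ∈ V, ∀ I ∈ A, NzdMod I v := by
  classical
  have hsmul : ∀ (I : Ideal (MvPolynomial σ K)) (r u : MvPolynomial σ K),
      r • Ideal.Quotient.mk I u = Ideal.Quotient.mk I (r * u) := fun _ _ _ => rfl
  set T : Set (Ideal (MvPolynomial σ K)) :=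
    ⋃ I ∈ A, associatedPrimes (MvPolynomial σ K) (MvPolynomial σ K ⧸ I) with hT
  have hTf : T.Finite := hA.biUnion fun I _ => associatedPrimes.finite _ _
  have key : ∀ P ∈ T, Submodule.comap V.subtype (P.restrictScalars K) ≠ ⊤ := by
    intro P hP htop
    obtain ⟨I, hI, hP⟩ := Set.mem_iUnion₂.1 hP
    rw [AssociatedPrimes.mem_iff, isAssociatedPrime_iff] at hP
    obtain ⟨hprime, x, rfl⟩ := hP
    obtain ⟨u, rfl⟩ := Ideal.Quotient.mk_surjective x
    have hmem : ∀ r, r ∈ (⊥ : Submodule (MvPolynomial σ K) (MvPolynomial σ K ⧸ I)).colon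
        {Ideal.Quotient.mk I u} ↔ r * u ∈ I := by
      intro r
      rw [Submodule.mem_colon_singleton, Submodule.mem_bot, hsmul, Ideal.Quotient.eq_zero_iff_mem]
    have hX := hV I hI _ hprime (fun r hr => (hmem r).2 (Ideal.mul_mem_right _ _ hr)) (by
      intro v hv
      have : (⟨v, hv⟩ : V) ∈ (⊤ : Submodule K V) := trivial
      rw [← htop] at this
      exact this)
    have hu : u ∈ I := hsoc I hI u fun i => (hmem _).1 (hX i)
    exact hprime.ne_top ((Ideal.eq_top_iff_one _).2 ((hmem 1).2 (by simpa using hu)))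
  have hcov := Subspace.biUnion_ne_univ_of_top_notMem (k := K) (E := V)
    (s := hTf.toFinset.image fun P => Submodule.comap V.subtype (P.restrictScalars K)) (by
      simp only [Finset.mem_image, Set.Finite.mem_toFinset, not_exists, not_and]
      exact key)
  obtain ⟨v, hv⟩ := (Set.ne_univ_iff_exists_notMem _).1 hcov
  refine ⟨v, v.2, fun I hI w hw => ?_⟩
  by_contra hwI
  apply hv
  have hzero : (v : MvPolynomial σ K) ∈
      {r : MvPolynomial σ K | ∃ x : MvPolynomial σ K ⧸ I, x ≠ 0 ∧ r • x = 0} := by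
    refine ⟨Ideal.Quotient.mk I w, by rwa [Ne, Ideal.Quotient.eq_zero_iff_mem], ?_⟩
    rwa [hsmul, Ideal.Quotient.eq_zero_iff_mem]
  rw [← biUnion_associatedPrimes_eq_zero_divisors] at hzero
  obtain ⟨P, hP, hvP⟩ := Set.mem_iUnion₂.1 hzero
  refine Set.mem_iUnion₂.2 ⟨_, Finset.mem_image_of_mem _
    (hTf.mem_toFinset.2 (Set.mem_biUnion hI hP)), hvP⟩

/-- The linear form with the given coefficients. -/
noncomputable def linForm [Fintype σ] : (σ → K) →ₗ[K] MvPolynomial σ K :=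
  Fintype.linearCombination K X

lemma linForm_single [Fintype σ] [DecidableEq σ] (i : σ) :
    linForm (Pi.single i 1 : σ → K) = X i := by
  simp [linForm]

lemma linForm_isHomogeneous [Fintype σ] (a : σ → K) : (linForm a).IsHomogeneous 1 := by
  rw [linForm, Fintype.linearCombination_apply]
  exact IsHomogeneous.sum _ _ _ fun i _ =>
    (homogeneousSubmodule σ K 1).smul_mem _ (isHomogeneous_X K i)

lemma linForm_mem [Fintype σ] (a : σ → K) :
    linForm a ∈ Ideal.span (Set.range (X : σ → MvPolynomial σ K)) := by
  rw [linForm, Fintype.linearCombination_apply]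
  exact sum_mem fun i _ => Submodule.smul_of_tower_mem _ _ (Ideal.subset_span ⟨i, rfl⟩)

lemma exists_nzdMod_X [Fintype σ] (W : Submodule K (σ → K)) (hW : W ≠ ⊤) :
    ∃ i, NzdMod (Ideal.span (linForm '' (W : Set (σ → K)))) (X i) := by
  classical
  set I := Ideal.span (linForm '' (W : Set (σ → K))) with hI
  obtain ⟨lam, hne, hker⟩ := Submodule.exists_le_ker_of_lt_top W (lt_top_iff_ne_top.2 hW)
  obtain ⟨i, hi⟩ : ∃ i, lam (Pi.single i 1) ≠ 0 := by
    by_contra! h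
    apply hne
    ext i
    simpa using h i
  refine ⟨i, fun u hu => ?_⟩
  let ψ : MvPolynomial σ K →ₐ[K] Polynomial (MvPolynomial σ K ⧸ I) :=
    aeval fun j => Polynomial.C (Ideal.Quotient.mk I (X j)) +
      lam (Pi.single j 1) • Polynomial.X
  have hlin : ∀ a : σ → K, ψ (linForm a) =
      Polynomial.C (Ideal.Quotient.mk I (linForm a)) + lam a • Polynomial.X := by
    intro a
    have h1 : lam a = ∑ j, a j * lam (Pi.single j 1) := by
      conv_lhs => rw [pi_eq_sum_univ' a]
      simp [map_sum]
    rw [h1, linForm, Fintype.linearCombination_apply, map_sum, map_sum, map_sum, Finset.sum_smul,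
      ← Finset.sum_add_distrib]
    refine Finset.sum_congr rfl fun j _ => ?_
    rw [map_smul, aeval_X, smul_add, smul_smul]
    congr 1
    rw [← Ideal.Quotient.mkₐ_eq_mk K, map_smul, Polynomial.smul_C]
  have hker' : I ≤ RingHom.ker ψ := by
    refine Ideal.span_le.2 ?_
    rintro _ ⟨a, ha, rfl⟩
    have h1 : Ideal.Quotient.mk I (linForm a) = 0 :=
      Ideal.Quotient.eq_zero_iff_mem.2 (Ideal.subset_span ⟨a, ha, rfl⟩)
    have h2 : lam a = 0 := hker ha
    simp [RingHom.mem_ker, hlin, h1, h2]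
  have h0 : ψ (X i * u) = 0 := hker' hu
  have heval : ∀ w, Polynomial.eval 0 (ψ w) = Ideal.Quotient.mk I w := by
    intro w
    have : ((Polynomial.aeval (0 : MvPolynomial σ K ⧸ I)).restrictScalars K).comp ψ =
        Ideal.Quotient.mkₐ K I := by
      ext j
      simp [ψ]
    simpa using DFunLike.congr_fun this w
  set b := lam (Pi.single i 1)
  have hmon : (Polynomial.X + Polynomial.C (b⁻¹ • Ideal.Quotient.mk I (X i))).Monic :=
    Polynomial.monic_X_add_C _
  have h3 : (Polynomial.X + Polynomial.C (b⁻¹ • Ideal.Quotient.mk I (X i))) * ψ u = 0 := by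
    have : (Polynomial.X + Polynomial.C (b⁻¹ • Ideal.Quotient.mk I (X i))) = b⁻¹ • ψ (X i) := by
      rw [aeval_X, smul_add, smul_smul, inv_mul_cancel₀ hi, one_smul, Polynomial.smul_C, add_comm]
    rw [this, smul_mul_assoc, ← map_mul, h0, smul_zero]
  have h4 : ψ u = 0 := hmon.mul_right_eq_zero_iff.1 h3
  rw [← Ideal.Quotient.eq_zero_iff_mem, ← heval, h4, Polynomial.eval_zero]

/-- The ideal contains the homogeneous components of its elements. -/
def HomIdeal (I : Ideal (MvPolynomial σ K)) : Prop :=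
  ∀ b ∈ I, ∀ j, homogeneousComponent j b ∈ I

lemma homogeneousComponent_mul_of_isHomogeneous {z : MvPolynomial σ K} {d : ℕ}
    (hz : z.IsHomogeneous d) (v : MvPolynomial σ K) (i : ℕ) :
    homogeneousComponent (i + d) (z * v) = z * homogeneousComponent i v := by
  classical
  conv_lhs => rw [← sum_homogeneousComponent v, Finset.mul_sum, map_sum]
  have : ∀ j, homogeneousComponent (i + d) (z * homogeneousComponent j v) =
      if j = i then z * homogeneousComponent i v else 0 := by
    intro j
    have hj : z * homogeneousComponent j v ∈ homogeneousSubmodule σ K (d + j) :=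
      hz.mul (homogeneousComponent_isHomogeneous j v)
    rw [homogeneousComponent_of_mem hj]
    by_cases h : j = i
    · subst h
      simp [add_comm]
    · rw [if_neg h, if_neg (by omega)]
  simp_rw [this]
  rw [Finset.sum_ite_eq' (Finset.range (v.totalDegree + 1)) i]
  split_ifs with h
  · rfl
  · rw [homogeneousComponent_eq_zero _ _ (by simpa using h), mul_zero]

lemma homIdeal_span {s : Set (MvPolynomial σ K)} (hs : ∀ x ∈ s, ∃ d, x.IsHomogeneous d) :
    HomIdeal (Ideal.span s) := by
  let _ := MvPolynomial.gradedAlgebra (σ := σ) (R := K)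
  intro b hb j
  exact homogeneousComponent_mem_of_mem (Ideal.homogeneous_span _ s hs) hb j

lemma mem_sup_of_exchange [Finite σ] {I : Ideal (MvPolynomial σ K)} (hI : HomIdeal I)
    {z h : MvPolynomial σ K} {d i : ℕ} (hz : z.IsHomogeneous 1) (hh : h.IsHomogeneous d)
    (hhI : NzdMod I h)
    (hS : ∀ i', i ≤ i' → ∀ w : MvPolynomial σ K, w.IsHomogeneous (i' + 1) →
      w ∈ I ⊔ Ideal.span {z})
    {w : MvPolynomial σ K} (hw : w.IsHomogeneous (i + d)) : w ∈ I ⊔ Ideal.span {h} := by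
  let π := (Ideal.Quotient.mkₐ K I).toLinearMap
  let N : ℕ → Submodule K (MvPolynomial σ K ⧸ I) := fun j => (homogeneousSubmodule σ K j).map π
  let L : MvPolynomial σ K → (MvPolynomial σ K ⧸ I) →ₗ[K] (MvPolynomial σ K ⧸ I) :=
    fun a => LinearMap.mulLeft K (π a)
  have hfin : ∀ j, Module.Finite K (N j) := fun j =>
    Module.Finite.iff_fg.2 ((homogeneousSubmodule_fg (σ := σ) (R := K) j).map π)
  have hπ : ∀ a b, π (a * b) = π a * π b := fun a b => map_mul (Ideal.Quotient.mkₐ K I) a b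
  have hker : ∀ a, π a = 0 ↔ a ∈ I := fun a => Ideal.Quotient.eq_zero_iff_mem
  have hstep : ∀ i', i ≤ i' → N (i' + 1) ≤ (N i').map (L z) := by
    rintro i' hi' _ ⟨w, hw, rfl⟩
    obtain ⟨b, hb, c, hc, hbc⟩ := Submodule.mem_sup.1 (hS i' hi' w hw)
    obtain ⟨v, rfl⟩ := Ideal.mem_span_singleton'.1 hc
    refine ⟨_, ⟨homogeneousComponent i' v, homogeneousComponent_isHomogeneous i' v, rfl⟩, ?_⟩
    have h1 : w = homogeneousComponent (i' + 1) b + z * homogeneousComponent i' v := by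
      rw [← homogeneousComponent_mul_of_isHomogeneous hz, ← map_add, mul_comm z, hbc,
        homogeneousComponent_eq_self hw]
    rw [h1, map_add, (hker _).2 (hI b hb _), zero_add, hπ]
    rfl
  have hdim : ∀ k, Module.finrank K (N (i + k)) ≤ Module.finrank K (N i) := by
    intro k
    induction k with
    | zero => exact le_rfl
    | succ k ih =>
      refine le_trans ?_ ih
      exact (Submodule.finrank_mono (hstep (i + k) (by omega))).trans
        (Submodule.finrank_map_le (L z) (N (i + k)))
  have hinj : Function.Injective (L h) := by
    refine (injective_iff_map_eq_zero _).2 fun x hx => ?_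
    obtain ⟨a, rfl⟩ := Ideal.Quotient.mk_surjective x
    exact (hker a).2 (hhI a ((hker _).1 ((hπ h a).trans hx)))
  have hle : (N i).map (L h) ≤ N (i + d) := by
    rintro _ ⟨_, ⟨a, ha, rfl⟩, rfl⟩
    refine ⟨h * a, ?_, hπ h a⟩
    rw [add_comm]
    exact hh.mul ha
  have heq : (N i).map (L h) = N (i + d) := by
    refine Submodule.eq_of_le_of_finrank_le hle ?_
    rw [← (Submodule.equivMapOfInjective _ hinj (N i)).finrank_eq]
    exact hdim d
  obtain ⟨_, ⟨a, -, rfl⟩, ha⟩ : π w ∈ (N i).map (L h) := heq ▸ ⟨w, hw, rfl⟩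
  have h2 : w - h * a ∈ I := by
    rw [← hker, map_sub, hπ, ← ha]
    exact sub_self _
  rw [← sub_add_cancel w (h * a)]
  exact add_mem (Ideal.mem_sup_left h2)
    (Ideal.mem_sup_right (Ideal.mul_mem_right _ _ (Ideal.mem_span_singleton_self h)))

lemma mem_span_X_of_isHomogeneous {w : MvPolynomial σ K} {j : ℕ} (hw : w.IsHomogeneous j)
    (hj : j ≠ 0) : w ∈ Ideal.span (Set.range (X : σ → MvPolynomial σ K)) := by
  rw [← Set.image_univ, mem_ideal_span_X_image]
  intro a ha
  by_contra! h
  have h0 : a = 0 := by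
    ext i
    simpa using h i (Set.mem_univ i)
  subst h0
  have := hw (mem_support_iff.1 ha)
  simp at this
  exact hj this.symm

lemma one_notMem_span_X : (1 : MvPolynomial σ K) ∉ Ideal.span (Set.range X) := by
  rw [← Set.image_univ, mem_ideal_span_X_image]
  intro h
  obtain ⟨i, -, hi⟩ := h 0 (by simp)
  exact hi rfl

lemma mem_sup_span_singleton_iff {R : Type*} [CommRing R] {I : Ideal R} {h x : R} :
    x ∈ I ⊔ Ideal.span {h} ↔ ∃ v, x - h * v ∈ I := by
  constructor
  · intro hx
    obtain ⟨b, hb, c, hc, rfl⟩ := Submodule.mem_sup.1 hx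
    obtain ⟨v, rfl⟩ := Ideal.mem_span_singleton'.1 hc
    exact ⟨v, by simpa [mul_comm h] using hb⟩
  · rintro ⟨v, hv⟩
    rw [← sub_add_cancel x (h * v)]
    exact add_mem (Ideal.mem_sup_left hv)
      (Ideal.mem_sup_right (Ideal.mul_mem_right _ _ (Ideal.mem_span_singleton_self h)))

lemma noSocle_of_exchange {I : Ideal (MvPolynomial σ K)} {z h : MvPolynomial σ K}
    (hh : NzdMod I h) (hz : NzdMod I z)
    (hzm : z ∈ Ideal.span (Set.range (X : σ → MvPolynomial σ K)))
    (hs : NoSocle (I ⊔ Ideal.span {z})) : NoSocle (I ⊔ Ideal.span {h}) := by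
  intro u hu
  obtain ⟨v, hv⟩ := mem_sup_span_singleton_iff.1 (mul_mem_of_X_mul_mem hu hzm)
  have hvz : v ∈ I ⊔ Ideal.span {z} := by
    refine hs v fun i => mem_sup_span_singleton_iff.2 ?_
    obtain ⟨v', hv'⟩ := mem_sup_span_singleton_iff.1 (hu i)
    refine ⟨v', hh _ ?_⟩
    have : h * (X i * v - z * v') = z * (X i * u - h * v') - X i * (z * u - h * v) := by ring
    rw [this]
    exact sub_mem (Ideal.mul_mem_left _ _ hv') (Ideal.mul_mem_left _ _ hv)
  obtain ⟨w, hw⟩ := mem_sup_span_singleton_iff.1 hvz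
  refine mem_sup_span_singleton_iff.2 ⟨w, hz _ ?_⟩
  have : z * (u - h * w) = (z * u - h * v) + h * (v - z * w) := by ring
  rw [this]
  exact add_mem hv (Ideal.mul_mem_left _ _ hw)

theorem regMod_homogeneous [Fintype σ] [Infinite K] (l : List (MvPolynomial σ K × ℕ))
    (hhom : ∀ x ∈ l, x.1.IsHomogeneous x.2)
    (hm : ∀ x ∈ l, x.1 ∈ Ideal.span (Set.range (X : σ → MvPolynomial σ K)))
    (W : Submodule K (σ → K))
    (hreg : RegMod (Ideal.span (linForm '' (W : Set (σ → K)))) (l.map Prod.fst)) :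
    Module.finrank K W + l.length ≤ Fintype.card σ ∧
    (Module.finrank K W + l.length < Fintype.card σ →
      NoSocle (Ideal.span (linForm '' (W : Set (σ → K))) ⊔ Ideal.ofList (l.map Prod.fst))) ∧
    (Module.finrank K W + l.length = Fintype.card σ →
      ∀ (j : ℕ) (w : MvPolynomial σ K), w.IsHomogeneous j →
        (l.map Prod.snd).sum + 1 ≤ j + l.length →
        w ∈ Ideal.span (linForm '' (W : Set (σ → K))) ⊔ Ideal.ofList (l.map Prod.fst)) := by
  classical
  induction l using List.reverseRecOn generalizing W with
  | nil =>
    simp only [List.length_nil, add_zero, List.map_nil, Ideal.ofList_nil, sup_bot_eq, List.sum_nil,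
      zero_add]
    refine ⟨by simpa using Submodule.finrank_le W, fun h => ?_, fun h j w hw hj => ?_⟩
    · obtain ⟨i, hi⟩ := exists_nzdMod_X W (by
        rintro rfl
        simp at h)
      exact fun u hu => hi u (hu i)
    · have hW : W = ⊤ := Submodule.eq_top_of_finrank_eq (by simpa using h)
      subst hW
      refine Ideal.span_mono ?_ (mem_span_X_of_isHomogeneous hw (by omega))
      rintro _ ⟨i, rfl⟩
      exact ⟨Pi.single i 1, trivial, linForm_single i⟩
  | append_singleton l hd ih =>
    obtain ⟨h, d⟩ := hd
    set Z := Ideal.span (linForm '' (W : Set (σ → K))) with hZ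
    set m := Ideal.span (Set.range (X : σ → MvPolynomial σ K)) with hmdef
    simp only [List.map_append, List.map_cons, List.map_nil] at hreg
    obtain ⟨hregl, hnzd, -⟩ := regMod_append.1 hreg
    have hhm : h ∈ m := hm (h, d) (by simp)
    have hml : ∀ x ∈ l, x.1 ∈ m := fun x hx => hm x (by simp [hx])
    have hZm : Z ≤ m := by
      rw [hZ, Ideal.span_le]
      rintro _ ⟨a, -, rfl⟩
      exact linForm_mem a
    have hsoc : ∀ l', l' <+: l.map Prod.fst → NoSocle (Z ⊔ Ideal.ofList l') := by
      rintro l' ⟨l'', hl''⟩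
      rw [← hl'', List.append_assoc] at hreg
      have h2 := (regMod_append.1 hreg).2
      cases l'' with
      | nil => exact h2.1.noSocle hhm
      | cons a l'' =>
        refine h2.1.noSocle ?_
        have : a ∈ l.map Prod.fst := by simp [← hl'']
        obtain ⟨x, hx, rfl⟩ := List.mem_map.1 this
        exact hml x hx
    obtain ⟨z, ⟨a, rfl⟩, hz⟩ := exists_nzdMod
      ((fun l' => Z ⊔ Ideal.ofList l') '' {l' | l' <+: l.map Prod.fst})
      (Set.Finite.image _ (by
        refine ((l.map Prod.fst).inits.toFinset.finite_toSet).subset fun l' hl' => ?_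
        simpa using hl'))
      (LinearMap.range (linForm (σ := σ) (K := K))) (by
        rintro _ ⟨l', hl', rfl⟩
        exact hsoc l' hl') (by
        intro I _ P _ _ hP i
        exact hP ⟨Pi.single i 1, linForm_single i⟩)
    have hz' : ∀ l', l' <+: l.map Prod.fst → NzdMod (Z ⊔ Ideal.ofList l') (linForm a) :=
      fun l' hl' => hz _ ⟨l', hl', rfl⟩
    have haW : a ∉ W := by
      intro ha
      have h1 := hz' [] (by simp) 1
      simp only [Ideal.ofList_nil, sup_bot_eq, mul_one] at h1
      exact one_notMem_span_X (hZm (h1 (Ideal.subset_span ⟨a, ha, rfl⟩)))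
    have hW' : Ideal.span (linForm '' ((W ⊔ Submodule.span K {a} : Submodule K (σ → K)) :
        Set (σ → K))) = Z ⊔ Ideal.span {linForm a} := by
      refine le_antisymm ?_ (sup_le (Ideal.span_mono (Set.image_mono
        (SetLike.coe_subset_coe.2 le_sup_left))) ?_)
      · rw [Ideal.span_le]
        rintro _ ⟨b, hb, rfl⟩
        obtain ⟨x, hx, y, hy, rfl⟩ := Submodule.mem_sup.1 hb
        obtain ⟨r, rfl⟩ := Submodule.mem_span_singleton.1 hy
        rw [map_add, map_smul]
        exact add_mem (Ideal.mem_sup_left (Ideal.subset_span ⟨x, hx, rfl⟩))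
          (Submodule.smul_of_tower_mem _ _ (Ideal.mem_sup_right (Ideal.mem_span_singleton_self _)))
      · rw [Ideal.span_singleton_le_iff_mem]
        exact Ideal.subset_span ⟨a, Submodule.mem_sup_right (Submodule.mem_span_singleton_self a),
          rfl⟩
    have hrank : Module.finrank K (W ⊔ Submodule.span K {a} : Submodule K (σ → K)) =
        Module.finrank K W + 1 :=
      Submodule.finrank_sup_span_singleton haW
    obtain ⟨ih1, ih2, ih3⟩ := ih (fun x hx => hhom x (by simp [hx])) hml
      (W ⊔ Submodule.span K {a}) (hW' ▸ regMod_insert hregl hz')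
    rw [hW', hrank, sup_right_comm] at ih2 ih3
    rw [hrank] at ih1
    simp only [List.length_append, List.length_singleton, List.map_append, List.map_cons,
      List.map_nil, Ideal.ofList_append, Ideal.ofList_singleton, List.sum_append,
      List.sum_singleton, ← sup_assoc]
    set I := Z ⊔ Ideal.ofList (l.map Prod.fst) with hI
    have hnz : NzdMod I (linForm a) := hz' _ (List.prefix_refl _)
    have hIm : I ≤ m := sup_le hZm (Ideal.span_le.2 fun x hx => by
      obtain ⟨y, hy, rfl⟩ := List.mem_map.1 hx
      exact hml y hy)
    refine ⟨by omega, fun hlt => ?_, fun hle j w hw hj => ?_⟩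
    · exact noSocle_of_exchange hnzd hnz (linForm_mem a) (ih2 (by omega))
    · have hhd : h.IsHomogeneous d := hhom (h, d) (by simp)
      have hHom : HomIdeal I := by
        rw [hI, hZ, Ideal.ofList, ← Ideal.span_union]
        refine homIdeal_span ?_
        rintro x (⟨b, -, rfl⟩ | hx)
        · exact ⟨1, linForm_isHomogeneous b⟩
        · obtain ⟨y, hy, rfl⟩ := List.mem_map.1 hx
          exact ⟨y.2, hhom y (by simp [hy])⟩
      have hdj : d ≤ j := by
        by_contra hlt
        have := ih3 (by omega) 0 1 (isHomogeneous_one _ _) (by omega)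
        exact one_notMem_span_X (sup_le hIm
          ((Ideal.span_singleton_le_iff_mem _).2 (linForm_mem a)) this)
      obtain ⟨i, rfl⟩ := Nat.exists_eq_add_of_le' hdj
      exact mem_sup_of_exchange hHom (linForm_isHomogeneous a) hhd hnzd
        (fun i' hi' w hw => ih3 (by omega) (i' + 1) w hw (by omega)) hw

lemma span_linForm_bot [Fintype σ] :
    Ideal.span (linForm '' ((⊥ : Submodule K (σ → K)) : Set (σ → K))) = ⊥ := by
  simp

theorem mem_ofList_sup_span_of_infinite [Fintype σ] [Infinite K]
    {V : Submodule K (MvPolynomial σ K)} {δ : ℕ} (hVhom : ∀ v ∈ V, v.IsHomogeneous δ)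
    (hVm : ∀ v ∈ V, v ∈ Ideal.span (Set.range (X : σ → MvPolynomial σ K))) (r : ℕ)
    (l : List (MvPolynomial σ K × ℕ)) (hhom : ∀ x ∈ l, x.1.IsHomogeneous x.2)
    (hm : ∀ x ∈ l, x.1 ∈ Ideal.span (Set.range (X : σ → MvPolynomial σ K)))
    (hreg : RegMod ⊥ (l.map Prod.fst)) (hr : l.length + r = Fintype.card σ)
    (hP : ∀ P : Ideal (MvPolynomial σ K), P.IsPrime → Ideal.ofList (l.map Prod.fst) ≤ P →
      (V : Set (MvPolynomial σ K)) ⊆ P → ∀ i, X i ∈ P)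
    {j : ℕ} {w : MvPolynomial σ K} (hw : w.IsHomogeneous j)
    (hj : (l.map Prod.snd).sum + r * δ + 1 ≤ j + Fintype.card σ) :
    w ∈ Ideal.ofList (l.map Prod.fst) ⊔ Ideal.span (V : Set (MvPolynomial σ K)) := by
  induction r generalizing l with
  | zero =>
    have h := (regMod_homogeneous l hhom hm ⊥ (by rwa [span_linForm_bot])).2.2 (by simpa using hr)
      j w hw (by omega)
    rw [span_linForm_bot, bot_sup_eq] at h
    exact Ideal.mem_sup_left h
  | succ r ih =>
    have hs := (regMod_homogeneous l hhom hm ⊥ (by rwa [span_linForm_bot])).2.1 (by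
      simp; omega)
    rw [span_linForm_bot, bot_sup_eq] at hs
    obtain ⟨g, hgV, hg⟩ := exists_nzdMod {Ideal.ofList (l.map Prod.fst)} (Set.finite_singleton _) V
      (by simpa using hs) (by simpa using hP)
    have h := ih (l ++ [(g, δ)])
      (by
        simp only [List.mem_append, List.mem_singleton]
        rintro x (hx | rfl)
        exacts [hhom x hx, hVhom g hgV])
      (by
        simp only [List.mem_append, List.mem_singleton]
        rintro x (hx | rfl)
        exacts [hm x hx, hVm g hgV])
      (by
        rw [List.map_append, regMod_append]
        refine ⟨hreg, ?_, trivial⟩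
        rw [bot_sup_eq]
        exact hg _ rfl)
      (by simp; omega)
      (fun P hp hle => hP P hp (le_trans (by
        rw [List.map_append, Ideal.ofList_append]
        exact le_sup_left) hle))
      (by
        simp only [List.map_append, List.sum_append, List.map_cons, List.map_nil,
          List.sum_singleton]
        rw [Nat.succ_mul] at hj
        omega)
    refine (?_ : Ideal.ofList _ ⊔ _ ≤ _) h
    rw [List.map_append, Ideal.ofList_append]
    refine sup_le (sup_le le_sup_left (le_trans ?_ le_sup_right)) le_sup_right
    simpa [Ideal.ofList_singleton, Ideal.span_singleton_le_iff_mem] using Ideal.subset_span hgV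

end Poly

section Descent

attribute [local instance] MvPolynomial.algebraMvPolynomial

theorem mem_sup_span_of_isWeaklyRegular {F σ : Type*} [Field F] [Fintype σ] {c : ℕ}
    {f : Fin c → MvPolynomial σ F} {D : Fin c → ℕ} (hf : ∀ i, (f i).IsHomogeneous (D i))
    (hreg : RingTheory.Sequence.IsWeaklyRegular (MvPolynomial σ F) (List.ofFn f))
    {G : Set (MvPolynomial σ F)} {δ : ℕ} (hG : ∀ g ∈ G, g.IsHomogeneous δ)
    (hrad : (Ideal.span G ⊔ Ideal.span (Set.range f)).radical = Ideal.span (Set.range X)) :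
    c ≤ Fintype.card σ ∧ ∀ (j : ℕ) (w : MvPolynomial σ F), w.IsHomogeneous j →
      ∑ i, D i + (Fintype.card σ - c) * δ + 1 ≤ j + Fintype.card σ →
      w ∈ Ideal.span G ⊔ Ideal.span (Set.range f) := by
  classical
  let K := AlgebraicClosure F
  have : Infinite K := IsAlgClosed.instInfinite
  let φ := algebraMap (MvPolynomial σ F) (MvPolynomial σ K)
  have hφ : ∀ g, φ g = map (algebraMap F K) g := fun g => rfl
  have : Module.Free (MvPolynomial σ F) (MvPolynomial σ K) :=
    (inferInstance : Algebra.IsPushout F (MvPolynomial σ F) K (MvPolynomial σ K)).out.free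
  have hφX : ∀ i, φ (X i) = X i := fun i => by rw [hφ, map_X]
  have hφm : (Ideal.span (Set.range (X : σ → MvPolynomial σ F))).map φ =
      Ideal.span (Set.range (X : σ → MvPolynomial σ K)) := by
    rw [Ideal.map_span, ← Set.range_comp]
    congr 2
    ext i
    simp [hφX]
  have hle : Ideal.span G ⊔ Ideal.span (Set.range f) ≤ Ideal.span (Set.range X) :=
    hrad ▸ Ideal.le_radical
  have hφmem : ∀ g ∈ Ideal.span G ⊔ Ideal.span (Set.range f),
      φ g ∈ Ideal.span (Set.range (X : σ → MvPolynomial σ K)) := fun g hg =>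
    hφm ▸ Ideal.mem_map_of_mem φ (hle hg)
  let l : List (MvPolynomial σ K × ℕ) := List.ofFn fun i => (φ (f i), D i)
  have hfst : l.map Prod.fst = (List.ofFn f).map φ := by
    simp [l, List.map_ofFn, Function.comp_def]
  have hsnd : (l.map Prod.snd).sum = ∑ i, D i := by
    simp [l, List.map_ofFn, Function.comp_def, List.sum_ofFn]
  have hlen : l.length = c := by simp [l]
  have hlhom : ∀ x ∈ l, x.1.IsHomogeneous x.2 := by
    intro x hx
    obtain ⟨i, rfl⟩ := (List.mem_ofFn' _ _).1 hx
    exact (hf i).map _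
  have hlm : ∀ x ∈ l, x.1 ∈ Ideal.span (Set.range (X : σ → MvPolynomial σ K)) := by
    intro x hx
    obtain ⟨i, rfl⟩ := (List.mem_ofFn' _ _).1 hx
    exact hφmem _ (Ideal.mem_sup_right (Ideal.subset_span ⟨i, rfl⟩))
  have hlreg : RegMod ⊥ (l.map Prod.fst) := by
    rw [hfst]
    exact regMod_bot_of_isWeaklyRegular hreg.of_flat
  have hc : c ≤ Fintype.card σ := by
    have := (regMod_homogeneous l hlhom hlm ⊥ (by rwa [span_linForm_bot])).1
    simpa [hlen] using this
  refine ⟨hc, fun j w hw hj => ?_⟩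
  have hofList : Ideal.ofList (l.map Prod.fst) = (Ideal.span (Set.range f)).map φ := by
    rw [hfst, ← Ideal.map_ofList, Ideal.ofList]
    congr 2
    ext x
    exact List.mem_ofFn' _ _
  have hV : Ideal.span (Submodule.span K (φ '' G) : Set (MvPolynomial σ K)) =
      (Ideal.span G).map φ := by
    rw [Ideal.map_span]
    exact Submodule.span_span_of_tower _ _ _
  have key := mem_ofList_sup_span_of_infinite (V := Submodule.span K (φ '' G)) (δ := δ)
    (by
      suffices Submodule.span K (φ '' G) ≤ homogeneousSubmodule σ K δ from this
      rw [Submodule.span_le]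
      rintro _ ⟨g, hg, rfl⟩
      exact (hG g hg).map _)
    (by
      suffices Submodule.span K (φ '' G) ≤ (Ideal.span (Set.range X)).restrictScalars K from this
      rw [Submodule.span_le]
      rintro _ ⟨g, hg, rfl⟩
      exact hφmem _ (Ideal.mem_sup_left (Ideal.subset_span hg)))
    (Fintype.card σ - c) l hlhom hlm hlreg (by omega)
    (by
      intro P hPp hPf hPV i
      obtain ⟨k, hk⟩ : (X i : MvPolynomial σ F) ∈
          (Ideal.span G ⊔ Ideal.span (Set.range f)).radical := by
        rw [hrad]
        exact Ideal.subset_span ⟨i, rfl⟩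
      have h1 : (Ideal.span G ⊔ Ideal.span (Set.range f)).map φ ≤ P := by
        rw [Ideal.map_sup, ← hofList, ← hV]
        exact sup_le (Ideal.span_le.2 hPV) hPf
      have h2 := h1 (Ideal.mem_map_of_mem φ hk)
      rw [map_pow, hφX] at h2
      exact hPp.mem_of_pow_mem k h2)
    (hw.map (algebraMap F K)) (by rwa [hsnd])
  rw [hofList, hV, ← Ideal.map_sup, sup_comm] at key
  rw [← Ideal.comap_map_eq_self_of_faithfullyFlat (B := MvPolynomial σ K)
    (Ideal.span G ⊔ Ideal.span (Set.range f))]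
  exact key

end Descent

section Frobenius

variable {σ F : Type*} [Field F]

lemma pow_mem_span_X_pow (p : ℕ) [Fact p.Prime] [CharP F p] {e : ℕ} {g : MvPolynomial σ F}
    (hg : g ∈ Ideal.span (Set.range fun j => (X j : MvPolynomial σ F) ^ p ^ e)) :
    g ^ p ∈ Ideal.span (Set.range fun j => (X j : MvPolynomial σ F) ^ p ^ (e + 1)) := by
  have h := Ideal.mem_map_of_mem (frobenius (MvPolynomial σ F) p) hg
  rw [Ideal.map_span, ← Set.range_comp] at h
  simpa only [Function.comp_def, frobenius_def, ← pow_mul, ← pow_succ] using h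

lemma pderiv_pow_eq_zero (p : ℕ) [CharP F p] (i : σ) (g : MvPolynomial σ F) :
    pderiv i (g ^ p) = 0 := by
  rw [Derivation.leibniz_pow, ← Nat.cast_smul_eq_nsmul (MvPolynomial σ F), CharP.cast_eq_zero,
    zero_smul]

lemma pderiv_mem_span_X_pow (p : ℕ) [CharP F p] (e : ℕ) (i : σ) {g : MvPolynomial σ F}
    (hg : g ∈ Ideal.span (Set.range fun j => (X j : MvPolynomial σ F) ^ p ^ (e + 1))) :
    pderiv i g ∈ Ideal.span (Set.range fun j => (X j : MvPolynomial σ F) ^ p ^ (e + 1)) := by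
  induction hg using Submodule.span_induction with
  | mem x hx =>
    obtain ⟨j, rfl⟩ := hx
    simp only [pow_succ, pow_mul, pderiv_pow_eq_zero]
    exact zero_mem _
  | zero => simp
  | add x y _ _ hx hy => rw [map_add]; exact add_mem hx hy
  | smul a x hx h =>
    rw [smul_eq_mul, Derivation.leibniz, smul_eq_mul, smul_eq_mul]
    exact add_mem (Ideal.mul_mem_left _ _ h) (Ideal.mul_mem_right _ _ hx)

lemma mem_span_X_pow_iff {q : ℕ} {g : MvPolynomial σ F} :
    g ∈ Ideal.span (Set.range fun j => (X j : MvPolynomial σ F) ^ q) ↔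
      ∀ b ∈ g.support, ∃ j, q ≤ b j := by
  have : (Set.range fun j => (X j : MvPolynomial σ F) ^ q) =
      (fun s => monomial s (1 : F)) '' Set.range fun j => Finsupp.single j q := by
    rw [← Set.range_comp]
    congr 1
    ext1 j
    simp [X_pow_eq_monomial]
  rw [this, mem_ideal_span_monomial_image]
  simp [Finsupp.single_le_iff]

/-- Socle duality: a form outside `(x_j ^ q)` is kept outside by a complementary monomial. -/
lemma exists_monomial_mul_notMem_span_X_pow [Fintype σ] {q A : ℕ} {g : MvPolynomial σ F}
    (hgA : g.IsHomogeneous A)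
    (hg : g ∉ Ideal.span (Set.range fun j => (X j : MvPolynomial σ F) ^ q)) :
    ∃ (j : ℕ) (w : MvPolynomial σ F), w.IsHomogeneous j ∧
      j + Fintype.card σ + A = Fintype.card σ * q ∧
      w * g ∉ Ideal.span (Set.range fun j => (X j : MvPolynomial σ F) ^ q) := by
  rw [mem_span_X_pow_iff] at hg
  push Not at hg
  obtain ⟨b, hb, hbq⟩ := hg
  let b' : σ →₀ ℕ := Finsupp.equivFunOnFinite.symm fun j => q - 1 - b j
  refine ⟨b'.degree, monomial b' 1, isHomogeneous_monomial _ rfl, ?_, ?_⟩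
  · have hA : b.degree = A := by
      by_contra h
      exact (mem_support_iff.1 hb) (hgA.coeff_eq_zero h)
    rw [← hA, Finsupp.degree_eq_sum, Finsupp.degree_eq_sum, Fintype.card_eq_sum_ones,
      Finset.sum_mul, ← Finset.sum_add_distrib, ← Finset.sum_add_distrib]
    refine Finset.sum_congr rfl fun j _ => ?_
    have := hbq j
    simp [b']
    omega
  · rw [mem_span_X_pow_iff]
    push Not
    refine ⟨b' + b, ?_, fun j => ?_⟩
    · rw [mem_support_iff, coeff_monomial_mul, one_mul]
      exact mem_support_iff.1 hb
    · have := hbq j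
      simp [b']
      omega

end Frobenius

section Jacobian

lemma derivation_prod {ι R A : Type*} [DecidableEq ι] [CommRing R] [CommRing A] [Algebra R A]
    (δ : Derivation R A A) (s : Finset ι) (g : ι → A) :
    δ (∏ i ∈ s, g i) = ∑ i ∈ s, (∏ j ∈ s.erase i, g j) * δ (g i) := by
  induction s using Finset.induction_on with
  | empty => simp
  | insert k s hk ih =>
    rw [Finset.prod_insert hk, Derivation.leibniz, ih, Finset.sum_insert hk,
      Finset.erase_insert hk, smul_eq_mul, smul_eq_mul, add_comm, Finset.mul_sum]
    congr 1
    refine Finset.sum_congr rfl fun i hi => ?_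
    rw [Finset.erase_insert_of_ne (by rintro rfl; exact hk hi),
      Finset.prod_insert (by simp [hk]), mul_assoc]

variable {σ F : Type*} [Field F] {c : ℕ}

lemma isHomogeneous_det_pderiv {f : Fin c → MvPolynomial σ F} {D : Fin c → ℕ}
    (hf : ∀ i, (f i).IsHomogeneous (D i)) (r : Fin c → σ) :
    (Matrix.det (Matrix.of fun i j : Fin c => pderiv (r i) (f j))).IsHomogeneous
      (∑ i, (D i - 1)) := by
  rw [Matrix.det_apply]
  refine IsHomogeneous.sum _ _ _ fun τ _ => ?_
  rw [Units.smul_def, ← Int.cast_smul_eq_zsmul F, smul_eq_C_mul]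
  refine (IsHomogeneous.prod _ _ _ fun i _ => (hf i).pderiv).C_mul _

/-- The Cramer rule applied to the gradient identities of `f_i * ∏ f_j ^ a_j * s ^ p`. -/
lemma det_pderiv_mul_mem (p : ℕ) [CharP F p] {e : ℕ} {f : Fin c → MvPolynomial σ F}
    {a : Fin c → ℕ} {s : MvPolynomial σ F} {i₀ : Fin c}
    (hi₀ : ((a i₀ + 1 : ℕ) : F) ≠ 0)
    (hmem : f i₀ * ((∏ i, f i ^ a i) * s ^ p) ∈
      Ideal.span (Set.range fun j => (X j : MvPolynomial σ F) ^ p ^ (e + 1))) (r : Fin c → σ) :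
    Matrix.det (Matrix.of fun i j : Fin c => pderiv (r i) (f j)) * ((∏ i, f i ^ a i) * s ^ p) ∈
      Ideal.span (Set.range fun j => (X j : MvPolynomial σ F) ^ p ^ (e + 1)) := by
  classical
  set Q := Ideal.span (Set.range fun j => (X j : MvPolynomial σ F) ^ p ^ (e + 1))
  set M := Matrix.of fun i j : Fin c => pderiv (r i) (f j)
  set a' := a + Pi.single i₀ 1
  have hprod : f i₀ * ((∏ i, f i ^ a i) * s ^ p) = (∏ i, f i ^ a' i) * s ^ p := by
    have : ∏ i, f i ^ (Pi.single i₀ 1 : Fin c → ℕ) i = f i₀ := by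
      rw [Finset.prod_eq_single i₀ (by intro b _ hb; simp [hb]) (by simp)]
      simp
    simp only [a', Pi.add_apply, pow_add, Finset.prod_mul_distrib, this]
    ring
  let v : Fin c → MvPolynomial σ F := fun j =>
    (∏ i ∈ Finset.univ.erase j, f i ^ a' i) * (a' j * f j ^ (a' j - 1)) * s ^ p
  have hv : ∀ k, M.mulVec v k ∈ Q := by
    intro k
    have h := pderiv_mem_span_X_pow p e (r k) hmem
    rw [hprod, Derivation.leibniz, pderiv_pow_eq_zero, smul_zero, zero_add,
      derivation_prod] at h
    convert h using 1
    rw [Matrix.mulVec, dotProduct, smul_eq_mul, Finset.mul_sum]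
    refine Finset.sum_congr rfl fun j _ => ?_
    rw [Derivation.leibniz_pow]
    simp only [v, M, Matrix.of_apply, smul_eq_mul, nsmul_eq_mul]
    ring
  have hdet : M.det * v i₀ ∈ Q := by
    have h : (M.adjugate.mulVec (M.mulVec v)) i₀ = M.det * v i₀ := by
      rw [Matrix.mulVec_mulVec, Matrix.adjugate_mul, Matrix.smul_mulVec, Matrix.one_mulVec]
      rfl
    rw [← h, Matrix.mulVec, dotProduct]
    exact sum_mem fun k _ => Ideal.mul_mem_left _ _ (hv k)
  have hvi : v i₀ = C ((a i₀ + 1 : ℕ) : F) * ((∏ i, f i ^ a i) * s ^ p) := by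
    have h1 : ∏ i ∈ Finset.univ.erase i₀, f i ^ a' i = ∏ i ∈ Finset.univ.erase i₀, f i ^ a i := by
      refine Finset.prod_congr rfl fun i hi => ?_
      simp [a', Finset.ne_of_mem_erase hi]
    have h2 : a' i₀ = a i₀ + 1 := by simp [a']
    simp only [v]
    rw [h1, h2, ← Finset.prod_erase_mul _ _ (Finset.mem_univ i₀), map_natCast,
      Nat.add_sub_cancel]
    ring
  rw [hvi] at hdet
  have := Ideal.mul_mem_left Q (C ((a i₀ + 1 : ℕ) : F)⁻¹) hdet
  convert this using 1
  have hC : (C ((a i₀ + 1 : ℕ) : F)⁻¹ : MvPolynomial σ F) * C ((a i₀ + 1 : ℕ) : F) = 1 := by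
    rw [← C_mul, inv_mul_cancel₀ hi₀, C_1]
  linear_combination (-(M.det * ((∏ i, f i ^ a i) * s ^ p))) * hC

/-- Among the exponents below `p`, a maximal one with `∏ f_i ^ a_i * g` outside `Q`. -/
lemma exists_maximal_prod_pow_mul_notMem {R : Type*} [CommRing R] (Q : Ideal R) {f : Fin c → R}
    {g : R} {p : ℕ} (hg : g ∉ Q) (hp : ∀ i, f i ^ p * g ∈ Q) :
    ∃ a : Fin c → ℕ, (∀ i, a i < p) ∧ (∏ i, f i ^ a i) * g ∉ Q ∧
      ∀ i, f i * ((∏ i, f i ^ a i) * g) ∈ Q := by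
  classical
  have hlt : ∀ a : Fin c → ℕ, (∏ i, f i ^ a i) * g ∉ Q → ∀ i, a i < p := by
    intro a ha i
    by_contra h
    push Not at h
    apply ha
    rw [← Finset.prod_erase_mul _ _ (Finset.mem_univ i), ← Nat.sub_add_cancel h, pow_add, mul_assoc,
      mul_assoc]
    exact Ideal.mul_mem_left _ _ (Ideal.mul_mem_left _ _ (hp i))
  have hfin : {a : Fin c → ℕ | (∏ i, f i ^ a i) * g ∉ Q}.Finite :=
    (Set.finite_Iic (fun _ : Fin c => p)).subset fun a ha i => (hlt a ha i).le
  obtain ⟨a, ha⟩ := hfin.exists_maximal ⟨0, by simpa using hg⟩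
  refine ⟨a, hlt a ha.prop, ha.prop, fun i => ?_⟩
  by_contra h
  have hprod : ∏ j, f j ^ (a + Pi.single i 1 : Fin c → ℕ) j = f i * ∏ j, f j ^ a j := by
    have : ∏ j, f j ^ (Pi.single i 1 : Fin c → ℕ) j = f i := by
      rw [Finset.prod_eq_single i (by intro b _ hb; simp [hb]) (by simp)]
      simp
    simp only [Pi.add_apply, pow_add, Finset.prod_mul_distrib, this, mul_comm]
  have hle := ha.le_of_ge (y := a + Pi.single i 1) (by
    show _ ∉ Q
    rwa [hprod, mul_assoc]) (by intro j; simp) i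
  simp at hle

end Jacobian

/-- **Algebraic core of Theorem 4.1.** Let `S = F[x_0, …, x_n]` with `char F = p > 0`,
let `f_1, …, f_c` be a regular sequence of homogeneous forms of degrees `d_1, …, d_c`,
`d := Σ d_i`, and let `J` be the ideal of `c × c` minors of the Jacobian matrix
`(∂f_j/∂x_i)`.  Assume `J + (f_1, …, f_c)` is `m`-primary.  Let `1 ≤ t ≤ p` with
`t·d_i ≥ (n+1-c)(d-c)+1` for each `i`.  Let `q = p^(e+1)` and let `s` be homogeneous of
degree `(n+1)q/p - d` with `f_i·s ∈ m^{[q/p]}` for each `i` and `s^p ∉ m^{[q]}`.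
Then `(f_1⋯f_c)^(p-t)·s^p ∉ m^{[q]}`. -/
theorem stmt_8 {F : Type*} [Field F] (p : ℕ) (hp : p.Prime) [CharP F p]
    (n c : ℕ) (f : Fin c → MvPolynomial (Fin (n + 1)) F) (D : Fin c → ℕ) (d : ℕ)
    (hfhom : ∀ i, (f i).IsHomogeneous (D i))
    (hreg : RingTheory.Sequence.IsRegular (MvPolynomial (Fin (n + 1)) F) (List.ofFn f))
    (hd : d = ∑ i, D i)
    (m J : Ideal (MvPolynomial (Fin (n + 1)) F))
    (hm : m = Ideal.span (Set.range X))
    (hJ : J = Ideal.span {g | ∃ r : Fin c → Fin (n + 1), Function.Injective r ∧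
      g = Matrix.det (Matrix.of fun i j : Fin c => pderiv (r i) (f j))})
    (hprimary : (J + Ideal.span (Set.range f)).radical = m)
    (t : ℕ) (ht1 : 1 ≤ t) (htp : t ≤ p)
    (htd : ∀ i, ((n : ℤ) + 1 - c) * ((d : ℤ) - c) + 1 ≤ (t : ℤ) * D i)
    (e Ds : ℕ) (s : MvPolynomial (Fin (n + 1)) F)
    (hDs : (Ds : ℤ) = ((n : ℤ) + 1) * (p : ℤ) ^ e - d)
    (hs : s.IsHomogeneous Ds)
    (hfs : ∀ i, f i * s ∈ Ideal.span (Set.range fun j => X j ^ p ^ e))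
    (hsp : s ^ p ∉ Ideal.span (Set.range fun j => X j ^ p ^ (e + 1))) :
    (∏ i, f i) ^ (p - t) * s ^ p ∉
      Ideal.span (Set.range fun j => (X j : MvPolynomial (Fin (n + 1)) F) ^ p ^ (e + 1)) := by
  intro hmem
  have : Fact p.Prime := ⟨hp⟩
  obtain ⟨a, hap, haQ, hfa⟩ := exists_maximal_prod_pow_mul_notMem _ (f := f) hsp fun i => by
    rw [← mul_pow]
    exact pow_mem_span_X_pow p (hfs i)
  obtain ⟨i₀, hi₀⟩ : ∃ i, a i < p - t := by
    by_contra! h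
    apply haQ
    have : ∏ i, f i ^ a i = (∏ i, f i ^ (a i - (p - t))) * (∏ i, f i) ^ (p - t) := by
      rw [← Finset.prod_pow, ← Finset.prod_mul_distrib]
      refine Finset.prod_congr rfl fun i _ => ?_
      rw [← pow_add, Nat.sub_add_cancel (h i)]
    rw [this, mul_assoc]
    exact Ideal.mul_mem_left _ _ hmem
  have hcast : ((a i₀ + 1 : ℕ) : F) ≠ 0 := by
    rw [Ne, CharP.cast_eq_zero_iff F p]
    exact Nat.not_dvd_of_pos_of_lt (Nat.succ_pos _) (by omega)
  have hkill : ∀ w ∈ J + Ideal.span (Set.range f), w * ((∏ i, f i ^ a i) * s ^ p) ∈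
      Ideal.span (Set.range fun j => (X j : MvPolynomial (Fin (n + 1)) F) ^ p ^ (e + 1)) := by
    intro w hw
    rw [hJ, Submodule.add_eq_sup, ← Ideal.span_union] at hw
    refine Submodule.mem_colon_singleton.1 (?_ : w ∈ Submodule.colon _ _)
    refine Ideal.span_le.2 ?_ hw
    rintro g (⟨r, -, rfl⟩ | ⟨i, rfl⟩)
    · exact Submodule.mem_colon_singleton.2 (det_pderiv_mul_mem p hcast (hfa i₀) r)
    · exact Submodule.mem_colon_singleton.2 (hfa i)
  have hfm : ∀ i, f i ∈ Ideal.span (Set.range (X : Fin (n + 1) → MvPolynomial (Fin (n + 1)) F)) :=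
    fun i => hm ▸ hprimary ▸ Ideal.le_radical (Ideal.mem_sup_right (Ideal.subset_span ⟨i, rfl⟩))
  have hD : ∀ i, 1 ≤ D i := by
    intro i
    by_contra! h
    refine ne_zero_of_regMod ((Ideal.ne_top_iff_one _).2 one_notMem_span_X) bot_le
      (fun h hh => by obtain ⟨j, rfl⟩ := (List.mem_ofFn' _ _).1 hh; exact hfm j)
      (regMod_bot_of_isWeaklyRegular hreg.toIsWeaklyRegular) (f i)
      ((List.mem_ofFn' _ _).2 ⟨i, rfl⟩) ?_
    have h0 := hfhom i
    rw [Nat.lt_one_iff.1 h] at h0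
    obtain ⟨x, hx⟩ : ∃ x, f i = C x := ⟨_, (totalDegree_eq_zero_iff_eq_C.1
      ((totalDegree_zero_iff_isHomogeneous _).2 h0))⟩
    by_cases hx0 : x = 0
    · simp [hx, hx0]
    · refine absurd ?_ (one_notMem_span_X (σ := Fin (n + 1)) (K := F))
      have := Ideal.mul_mem_left _ (C x⁻¹) (hfm i)
      rwa [hx, ← C_mul, inv_mul_cancel₀ hx0, C_1] at this
  obtain ⟨hc, hsat⟩ := mem_sup_span_of_isWeaklyRegular hfhom hreg.toIsWeaklyRegular
    (G := {g | ∃ r : Fin c → Fin (n + 1), Function.Injective r ∧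
      g = Matrix.det (Matrix.of fun i j : Fin c => pderiv (r i) (f j))})
    (δ := ∑ i, (D i - 1)) (by rintro _ ⟨r, -, rfl⟩; exact isHomogeneous_det_pderiv hfhom r)
    (by rw [← hJ, ← hm]; exact hprimary)
  have hGhom : ((∏ i, f i ^ a i) * s ^ p).IsHomogeneous (∑ i, D i * a i + Ds * p) :=
    (IsHomogeneous.prod _ _ _ fun i _ => (hfhom i).pow (a i)).mul (hs.pow p)
  obtain ⟨j, w, hw, hj, hwG⟩ := exists_monomial_mul_notMem_span_X_pow hGhom haQ
  refine hwG (hkill w ?_)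
  rw [hJ]
  refine hsat j w hw ?_
  rw [Fintype.card_fin] at *
  have hδ : ((∑ i, (D i - 1) : ℕ) : ℤ) = d - c := by
    rw [hd]
    push_cast
    rw [Finset.sum_congr rfl fun i _ => Nat.cast_pred (R := ℤ) (hD i)]
    simp
  have hsum : d + t * D i₀ ≤ ∑ i, (p - a i) * D i := by
    rw [hd, ← Finset.add_sum_erase _ _ (Finset.mem_univ i₀),
      ← Finset.add_sum_erase _ (fun i => (p - a i) * D i) (Finset.mem_univ i₀)]
    have h1 : ∑ i ∈ Finset.univ.erase i₀, D i ≤ ∑ i ∈ Finset.univ.erase i₀, (p - a i) * D i :=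
      Finset.sum_le_sum fun i _ => Nat.le_mul_of_pos_left _ (Nat.sub_pos_of_lt (hap i))
    have h2 : (t + 1) * D i₀ ≤ (p - a i₀) * D i₀ := Nat.mul_le_mul_right _ (by omega)
    rw [Nat.succ_mul] at h2
    omega
  have hsum' : ((∑ i, (p - a i) * D i : ℕ) : ℤ) = p * d - (∑ i, D i * a i : ℕ) := by
    rw [hd]
    push_cast
    rw [Finset.mul_sum, ← Finset.sum_sub_distrib]
    refine Finset.sum_congr rfl fun i _ => ?_
    rw [Nat.cast_sub (hap i).le]
    ring
  have hj' : (j : ℤ) + (n + 1) + ((∑ i, D i * a i : ℕ) + Ds * p) = (n + 1) * p ^ (e + 1) := by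
    exact_mod_cast hj
  have h3 := htd i₀
  rw [← hδ] at h3
  rw [hDs, pow_succ] at hj'
  rw [← hd]
  have hsum'' := (Nat.cast_le (α := ℤ)).2 hsum
  rw [hsum'] at hsum''
  generalize ∑ i, (D i - 1) = δ at h3 ⊢
  zify [hc]
  push_cast at hsum'' hj'
  linarith
end
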